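/- Let K be a field, let P be the kernel of the K-algebra homomorphism φ: K[x_1,...,x_n] → K[y_1,...,y_m] defined by φ(x_i) = f_i, where f_1,...,f_n are homogeneous polynomials all of the same degree d > 0. Then the Castelnuovo–Mumford regularity of P satisfies reg(P) ≤ d^(n·2^(m-1) − 1). -/

import Mathlib

open MvPolynomial

variable {K : Type} [Field K]

/-- The degree-`k` homogeneous component of a homogeneous ideal `I`,
as a `K`-vector subspace of the polynomial ring (zero in negative degrees). -/
noncomputable def idealPiece {n : ℕ} (I : Ideal (MvPolynomial (Fin n) K)) (k : ℤ) :
    Submodule K (MvPolynomial (Fin n) K) :=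
  if 0 ≤ k then
    (Submodule.restrictScalars K (I : Submodule (MvPolynomial (Fin n) K) (MvPolynomial (Fin n) K)))
      ⊓ (homogeneousSubmodule (Fin n) K k.toNat)
  else ⊥

lemma mul_X_mem_idealPiece {n : ℕ} (I : Ideal (MvPolynomial (Fin n) K)) (t : Fin n) (k : ℤ)
    {x : MvPolynomial (Fin n) K} (hx : x ∈ idealPiece I k) :
    (X t : MvPolynomial (Fin n) K) * x ∈ idealPiece I (k + 1) := by
  by_cases h : 0 ≤ k
  · rw [idealPiece, if_pos h] at hx
    rw [idealPiece, if_pos (by omega)]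
    refine ⟨I.mul_mem_left _ hx.1, ?_⟩
    rw [Submodule.mem_inf] at hx
    have hh : x.IsHomogeneous k.toNat := (mem_homogeneousSubmodule _ _).1 hx.2
    have : ((X t : MvPolynomial (Fin n) K) * x).IsHomogeneous (1 + k.toNat) :=
      (isHomogeneous_X K t).mul hh
    have he : (k + 1).toNat = 1 + k.toNat := by omega
    exact (mem_homogeneousSubmodule _ _).2 (he ▸ this)
  · rw [idealPiece, if_neg h, Submodule.mem_bot] at hx
    rw [hx, mul_zero]
    exact Submodule.zero_mem _

/-- Multiplication by the variable `X t` as a linear map between graded pieces. -/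
noncomputable def mulXPiece {n : ℕ} (I : Ideal (MvPolynomial (Fin n) K)) (t : Fin n) (k : ℤ) :
    idealPiece I k →ₗ[K] idealPiece I (k + 1) :=
  (LinearMap.mulLeft K (X t)).restrict (fun _ hx => mul_X_mem_idealPiece I t k hx)

/-- Index set of the `i`-th term of the Koszul complex: subsets of the variables of size `i`. -/
abbrev KoszulIdx (n i : ℕ) := {s : Finset (Fin n) // s.card = i}

/-- The Koszul differential (in internal degree `j`) of the complex computing
`Tor(I, K)`, from homological degree `i+1` to homological degree `i`. -/
noncomputable def koszulDiff {n : ℕ} (I : Ideal (MvPolynomial (Fin n) K)) (i : ℕ) (j : ℤ) :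
    ((KoszulIdx n (i + 1)) → idealPiece I (j - (i + 1 : ℕ)))
      →ₗ[K] ((KoszulIdx n i) → idealPiece I (j - (i : ℕ))) :=
  ∑ s' : KoszulIdx n (i + 1), ∑ t ∈ (s' : Finset (Fin n)).attach,
    ((-1 : K) ^ (((s' : Finset (Fin n)).filter (fun u => u < t.1)).card)) •
      ((LinearMap.single (R := K) (φ := fun _ : KoszulIdx n i => idealPiece I (j - (i : ℕ)))
          ⟨(s' : Finset (Fin n)).erase t.1, by
            rw [Finset.card_erase_of_mem t.2, s'.2]; rfl⟩) ∘ₗ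
        (LinearEquiv.ofEq _ _ (by rw [show j - ((i : ℕ) + 1 : ℕ) + 1 = j - (i : ℕ) by push_cast; ring])).toLinearMap ∘ₗ
        (mulXPiece I t.1 (j - ((i : ℕ) + 1 : ℕ))) ∘ₗ
        (LinearMap.proj s'))

/-- Cycles of the Koszul complex at homological degree `i`, internal degree `j`. -/
noncomputable def koszulCycles {n : ℕ} (I : Ideal (MvPolynomial (Fin n) K)) :
    (i : ℕ) → (j : ℤ) → Submodule K ((KoszulIdx n i) → idealPiece I (j - (i : ℕ)))
  | 0, _ => ⊤
  | (i + 1), j => LinearMap.ker (koszulDiff I i j)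

set_option synthInstance.maxHeartbeats 1000000 in
set_option maxHeartbeats 1000000 in
/-- The graded Betti number `β_{i,j}(I) = dim_K Tor_i(I, K)_j`, computed as the dimension
of the homology of the Koszul complex (all spaces involved are finite-dimensional, so the
dimension of the homology `Z/B` is `dim Z - dim (B ⊓ Z)`). -/
noncomputable def gradedBetti {n : ℕ} (I : Ideal (MvPolynomial (Fin n) K)) (i : ℕ) (j : ℤ) : ℕ :=
  Module.finrank K ↥(koszulCycles I i j) -
    Module.finrank K ↥(LinearMap.range (koszulDiff I i j) ⊓ koszulCycles I i j)

/-- The Castelnuovo–Mumford regularity `reg(I) = max { j - i : β_{i,j}(I) ≠ 0 }`. -/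
noncomputable def reg {n : ℕ} (I : Ideal (MvPolynomial (Fin n) K)) : ℤ :=
  sSup {r : ℤ | ∃ (i : ℕ) (j : ℤ), gradedBetti I i j ≠ 0 ∧ r = j - i}

/-- `t_i(I) = max { j : β_{i,j}(I) ≠ 0 }`, the maximal shift in homological degree `i`. -/
noncomputable def maxShift {n : ℕ} (I : Ideal (MvPolynomial (Fin n) K)) (i : ℕ) : ℤ :=
  sSup {j : ℤ | gradedBetti I i j ≠ 0}

/-- The projective dimension of `I`. -/
noncomputable def projdim {n : ℕ} (I : Ideal (MvPolynomial (Fin n) K)) : ℕ :=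
  sSup {i : ℕ | ∃ j : ℤ, gradedBetti I i j ≠ 0}

/-- An ideal of a polynomial ring is homogeneous (for the standard grading) if it contains
all homogeneous components of its elements. -/
def IsHomogeneousIdeal {n : ℕ} (I : Ideal (MvPolynomial (Fin n) K)) : Prop :=
  ∀ f ∈ I, ∀ k : ℕ, homogeneousComponent k f ∈ I

/-- The Koszul differential on the sequence `x`, acting on all exterior degrees at once: a chain
assigns to each set of variables its coefficient. -/
def koszulD {T : Type*} [CommRing T] {n : ℕ} (x : Fin n → T) (w : Finset (Fin n) → T)
    (G : Finset (Fin n)) : T :=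
  ∑ t, if t ∈ G then 0 else (-1) ^ (G.filter (· < t)).card * (x t * w (insert t G))

section KoszulD

variable {T : Type*} [CommRing T] {n : ℕ} (x : Fin n → T)

lemma koszulD_add (v w : Finset (Fin n) → T) (G : Finset (Fin n)) :
    koszulD x (fun F => v F + w F) G = koszulD x v G + koszulD x w G := by
  unfold koszulD
  rw [← Finset.sum_add_distrib]
  refine Finset.sum_congr rfl fun t _ => ?_
  split_ifs <;> ring

lemma koszulD_sub (v w : Finset (Fin n) → T) (G : Finset (Fin n)) :
    koszulD x (fun F => v F - w F) G = koszulD x v G - koszulD x w G := by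
  unfold koszulD
  rw [← Finset.sum_sub_distrib]
  refine Finset.sum_congr rfl fun t _ => ?_
  split_ifs <;> ring

variable {x} in
lemma koszulD_congr {v w : Finset (Fin n) → T} {G : Finset (Fin n)}
    (h : ∀ t ∉ G, v (insert t G) = w (insert t G)) : koszulD x v G = koszulD x w G := by
  unfold koszulD
  refine Finset.sum_congr rfl fun t _ => ?_
  split_ifs with ht
  · rfl
  · rw [h t ht]

variable {x} in
lemma koszulD_eq_zero {w : Finset (Fin n) → T} {G : Finset (Fin n)}
    (h : ∀ t ∉ G, w (insert t G) = 0) : koszulD x w G = 0 := by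
  unfold koszulD
  refine Finset.sum_eq_zero fun t _ => ?_
  split_ifs with ht
  · rfl
  · rw [h t ht, mul_zero, mul_zero]

lemma card_filter_lt_insert {G : Finset (Fin n)} {s t : Fin n} (ht : t ∉ G) :
    ((insert t G).filter (· < s)).card
      = (G.filter (· < s)).card + if t < s then 1 else 0 := by
  rw [Finset.filter_insert]
  split_ifs with h
  · rw [Finset.card_insert_of_notMem (by simp [ht])]
  · rfl

lemma koszulD_koszulD (w : Finset (Fin n) → T) (G : Finset (Fin n)) :
    koszulD x (koszulD x w) G = 0 := by
  have key : koszulD x (koszulD x w) G = ∑ p : Fin n × Fin n,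
      if p.1 ∈ G ∨ p.2 ∈ G ∨ p.1 = p.2 then 0 else
        (-1) ^ (G.filter (· < p.1)).card * ((-1) ^ ((insert p.1 G).filter (· < p.2)).card *
          (x p.1 * x p.2 * w (insert p.2 (insert p.1 G)))) := by
    rw [Fintype.sum_prod_type]
    unfold koszulD
    refine Finset.sum_congr rfl fun t _ => ?_
    by_cases ht : t ∈ G
    · simp [ht]
    · rw [if_neg ht, Finset.mul_sum, Finset.mul_sum]
      refine Finset.sum_congr rfl fun s _ => ?_
      by_cases hs : s ∈ G
      · simp [hs]
      · by_cases hst : t = s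
        · simp [hst]
        · have : s ∉ insert t G := by simp [hs, Ne.symm hst]
          simp only [this, ht, hs, hst, if_false, or_self]
          ring
  rw [key]
  refine Finset.sum_involution (fun p _ => (p.2, p.1)) ?_ ?_ (fun _ _ => Finset.mem_univ _)
    (fun _ _ => rfl)
  · rintro ⟨t, s⟩ -
    by_cases h : t ∈ G ∨ s ∈ G ∨ t = s
    · have h' : s ∈ G ∨ t ∈ G ∨ s = t := by tauto
      simp only [h, h', if_true, add_zero]
    · have h' : ¬ (s ∈ G ∨ t ∈ G ∨ s = t) := by tauto
      simp only [h, h', if_false]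
      push Not at h
      rw [card_filter_lt_insert h.1, card_filter_lt_insert h.2.1, Finset.insert_comm]
      rcases lt_or_gt_of_ne h.2.2 with hlt | hlt
      · simp only [hlt, hlt.not_gt, if_true, if_false]; ring
      · simp only [hlt, hlt.not_gt, if_true, if_false]; ring
  · rintro ⟨t, s⟩ - h hp
    apply h
    rw [if_pos]
    simp only [Prod.mk.injEq] at hp
    tauto

variable {x} in
lemma exists_of_koszulD_ne_zero {w : Finset (Fin n) → T} {G : Finset (Fin n)}
    (h : koszulD x w G ≠ 0) : ∃ t ∉ G, w (insert t G) ≠ 0 := by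
  by_contra! H
  exact h (koszulD_eq_zero H)

end KoszulD

/-- The complex spanned by the sets in `𝓕`, with the differential of the full simplex followed by
the projection to `𝓕`, has no homology in degree `i`. -/
def FamilyExact (K : Type*) [Field K] {n : ℕ} (𝓕 : Set (Finset (Fin n))) (i : ℕ) : Prop :=
  ∀ z : Finset (Fin n) → K, (∀ F, z F ≠ 0 → F ∈ 𝓕 ∧ F.card = i) →
    (∀ G ∈ 𝓕, koszulD (fun _ => 1) z G = 0) →
    ∃ w : Finset (Fin n) → K, (∀ F, w F ≠ 0 → F ∈ 𝓕 ∧ F.card = i + 1) ∧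
      ∀ G ∈ 𝓕, koszulD (fun _ => 1) w G = z G

section FamilyExact

variable {k : Type*} [Field k] {n : ℕ}

lemma FamilyExact.of_forall_card_ne {𝓕 : Set (Finset (Fin n))} {i : ℕ}
    (h : ∀ F ∈ 𝓕, F.card ≠ i) : FamilyExact k 𝓕 i := by
  intro z hz _
  have hz0 : ∀ F, z F = 0 := fun F => by
    by_contra hF
    exact h F (hz F hF).1 (hz F hF).2
  exact ⟨fun _ => 0, fun F hF => absurd rfl hF, fun G _ => by
    rw [hz0, koszulD_eq_zero fun _ _ => rfl]⟩

lemma FamilyExact.union {𝓕 𝓖 : Set (Finset (Fin n))} {i : ℕ}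
    (h𝓕 : FamilyExact k 𝓕 i) (h𝓖 : FamilyExact k 𝓖 i)
    (hlt : ∀ F ∈ 𝓕, ∀ G ∈ 𝓖, ¬ G ⊆ F) (hc : (𝓕 ∪ 𝓖).OrdConnected) :
    FamilyExact k (𝓕 ∪ 𝓖) i := by
  classical
  intro z hz hcyc
  have hz2 : ∀ G ∈ 𝓖, koszulD (fun _ => 1) (fun F => if F ∈ 𝓖 then z F else 0) G = 0 := by
    intro G hG
    refine Eq.trans (koszulD_congr fun t _ => ?_) (hcyc G (Or.inr hG))
    split_ifs with h
    · rfl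
    · by_contra hne
      rcases (hz _ (Ne.symm hne)).1 with h1 | h1
      · exact hlt _ h1 _ hG (Finset.subset_insert _ _)
      · exact h h1
  obtain ⟨w2, hw2, hw2'⟩ := h𝓖 _ (fun F hF => by
    split_ifs at hF with h
    · exact ⟨h, (hz F hF).2⟩
    · exact absurd rfl hF) hz2
  have hsupp : ∀ F, (z F - if F ∈ 𝓕 ∪ 𝓖 then koszulD (fun _ => 1) w2 F else 0) ≠ 0 →
      F ∈ 𝓕 ∧ F.card = i := by
    intro F hF
    have hmem : F ∈ 𝓕 ∪ 𝓖 := by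
      by_contra h
      rw [if_neg h, sub_zero] at hF
      exact h (hz F hF).1
    rw [if_pos hmem] at hF
    have hF2 : F ∉ 𝓖 := fun h => by
      rw [hw2' F h, if_pos h, sub_self] at hF
      exact hF rfl
    refine ⟨hmem.resolve_right hF2, ?_⟩
    by_cases hzF : z F = 0
    · rw [hzF, zero_sub, neg_ne_zero] at hF
      obtain ⟨t, ht, hwt⟩ := exists_of_koszulD_ne_zero hF
      have := (hw2 _ hwt).2
      rw [Finset.card_insert_of_notMem ht] at this
      omega
    · exact (hz F hzF).2
  obtain ⟨w1, hw1, hw1'⟩ := h𝓕 _ hsupp (fun G hG => by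
    rw [koszulD_sub, hcyc G (Or.inl hG), zero_sub, neg_eq_zero]
    refine Eq.trans (koszulD_congr fun t _ => ?_) (koszulD_koszulD (fun _ => (1 : k)) w2 G)
    split_ifs with h
    · rfl
    · by_contra hne
      obtain ⟨s, _, hws⟩ := exists_of_koszulD_ne_zero (Ne.symm hne)
      exact h (hc.out (Or.inl hG) (Or.inr (hw2 _ hws).1)
        ⟨Finset.subset_insert _ _, Finset.subset_insert _ _⟩))
  refine ⟨fun F => w1 F + w2 F, fun F hF => ?_, fun G hG => ?_⟩
  · by_cases h : w1 F = 0
    · beta_reduce at hF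
      rw [h, zero_add] at hF
      exact ⟨Or.inr (hw2 F hF).1, (hw2 F hF).2⟩
    · exact ⟨Or.inl (hw1 F h).1, (hw1 F h).2⟩
  · rw [koszulD_add]
    by_cases h : G ∈ 𝓖
    · rw [hw2' G h, if_pos h, koszulD_eq_zero, zero_add]
      intro t _
      by_contra hne
      exact hlt _ (hw1 _ hne).1 _ h (Finset.subset_insert _ _)
    · rw [hw1' G (hG.resolve_right h), if_pos hG, sub_add_cancel]

lemma FamilyExact.of_pairing {𝓕 : Set (Finset (Fin n))} (i : ℕ) (x : Fin n)
    (h : ∀ G, x ∉ G → (insert x G ∈ 𝓕 ↔ G ∈ 𝓕)) : FamilyExact k 𝓕 i := by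
  intro z hz hcyc
  refine ⟨fun F => if x ∈ F then (-1) ^ ((F.erase x).filter (· < x)).card * z (F.erase x) else 0,
    fun F hF => ?_, fun G hG => ?_⟩
  · beta_reduce at hF
    split_ifs at hF with hx
    · obtain ⟨h1, h2⟩ := hz _ (right_ne_zero_of_mul hF)
      refine ⟨?_, ?_⟩
      · rw [← h _ (Finset.notMem_erase x F), Finset.insert_erase hx] at h1
        exact h1
      · rw [← h2, Finset.card_erase_add_one hx]
    · exact absurd rfl hF
  · by_cases hx : x ∈ G
    · obtain ⟨G, hxG, rfl⟩ : ∃ G', x ∉ G' ∧ insert x G' = G :=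
        ⟨G.erase x, Finset.notMem_erase x G, Finset.insert_erase hx⟩
      have hG' := hcyc G ((h G hxG).1 hG)
      unfold koszulD at hG' ⊢
      rw [← Finset.add_sum_erase _ _ (Finset.mem_univ x), if_neg hxG] at hG'
      beta_reduce at hG' ⊢
      rw [← Finset.add_sum_erase _ _ (Finset.mem_univ x), if_pos hx, zero_add]
      have hsq : ((-1 : k) ^ (G.filter (· < x)).card) * (-1) ^ (G.filter (· < x)).card = 1 := by
        rw [← mul_pow]; simp
      have e : z (insert x G) = - ((-1 : k) ^ (G.filter (· < x)).card *
          ∑ t ∈ Finset.univ.erase x, if t ∈ G then 0 else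
            (-1) ^ (G.filter (· < t)).card * (1 * z (insert t G))) := by
        linear_combination (-1) ^ (G.filter (· < x)).card * hG' - z (insert x G) * hsq
      rw [e, Finset.mul_sum, ← Finset.sum_neg_distrib]
      refine Finset.sum_congr rfl fun t ht => ?_
      have htx : t ≠ x := Finset.ne_of_mem_erase ht
      by_cases htG : t ∈ G
      · simp [htG]
      · have h1 : t ∉ insert x G := by simp [htG, htx]
        have h2 : x ∈ insert t (insert x G) := by simp
        have h3 : (insert t (insert x G)).erase x = insert t G := by
          rw [Finset.insert_comm, Finset.erase_insert (by simp [hxG, htx.symm])]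
        rw [if_neg h1, if_pos h2, if_neg htG, h3, card_filter_lt_insert hxG,
          card_filter_lt_insert htG]
        rcases lt_or_gt_of_ne htx with hlt | hlt
        · simp only [hlt, hlt.not_gt, if_true, if_false]; ring
        · simp only [hlt, hlt.not_gt, if_true, if_false]; ring
    · unfold koszulD
      beta_reduce
      rw [Finset.sum_eq_single x]
      · rw [if_neg hx, if_pos (Finset.mem_insert_self x G), Finset.erase_insert hx, one_mul,
          ← mul_assoc, ← mul_pow]
        simp
      · intro t _ ht
        rw [if_neg (show x ∉ insert t G by simp [ht.symm, hx]), mul_zero, mul_zero, ite_self]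
      · simp

end FamilyExact

/-- The exponents of the monomials in `X^h • K[X_s : s ∈ u]`. -/
def cone {σ : Type*} (h : σ → ℕ) (u : Finset σ) : Set (σ → ℕ) :=
  {c | (∀ s, h s ≤ c s) ∧ ∀ s ∉ u, c s = h s}

/-- `ConeFiltration M Q` says that the monomial module with basis `M` has a filtration whose
quotients are spanned by cones, and `Q` lists the degree of the vertex and the dimension of each of
these cones. -/
inductive ConeFiltration {σ : Type*} [Fintype σ] : Set (σ → ℕ) → Multiset (ℕ × ℕ) → Prop
  | empty : ConeFiltration ∅ 0
  | single (h : σ → ℕ) (u : Finset σ) : ConeFiltration (cone h u) {(∑ s, h s, u.card)}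
  | union {M₁ M₂ : Set (σ → ℕ)} {Q₁ Q₂ : Multiset (ℕ × ℕ)} :
      ConeFiltration M₁ Q₁ → ConeFiltration M₂ Q₂ → (∀ p ∈ M₁, ∀ q ∈ M₂, ¬ p ≤ q) →
      (M₁ ∪ M₂).OrdConnected → ConeFiltration (M₁ ∪ M₂) (Q₁ + Q₂)

section Cone

variable {σ : Type*} {h : σ → ℕ} {u : Finset σ}

lemma ordConnected_cone (h : σ → ℕ) (u : Finset σ) : (cone h u).OrdConnected := by
  refine ⟨fun p hp q hq r hr => ⟨fun s => (hp.1 s).trans (hr.1 s), fun s hs => ?_⟩⟩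
  have h1 : p s ≤ r s := hr.1 s
  have h2 : r s ≤ q s := hr.2 s
  have h3 := hp.2 s hs
  have h4 := hq.2 s hs
  omega

lemma self_mem_cone (h : σ → ℕ) (u : Finset σ) : h ∈ cone h u := ⟨fun _ => le_rfl, fun _ _ => rfl⟩

variable [DecidableEq σ]

lemma cone_union_cone {x : σ} (hx : x ∈ u) :
    cone (h + Pi.single x 1) u ∪ cone h (u.erase x) = cone h u := by
  ext c
  constructor
  · rintro (hc | hc)
    · refine ⟨fun s => ?_, fun s hs => ?_⟩
      · have := hc.1 s
        simp only [Pi.add_apply] at this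
        omega
      · rw [hc.2 s hs, Pi.add_apply, Pi.single_eq_of_ne (by rintro rfl; exact hs hx), add_zero]
    · exact ⟨hc.1, fun s hs => hc.2 s fun h' => hs (Finset.mem_of_mem_erase h')⟩
  · intro hc
    by_cases hcx : c x = h x
    · refine Or.inr ⟨hc.1, fun s hs => ?_⟩
      by_cases hsx : s = x
      · rw [hsx, hcx]
      · exact hc.2 s fun h' => hs (Finset.mem_erase.2 ⟨hsx, h'⟩)
    · refine Or.inl ⟨fun s => ?_, fun s hs => ?_⟩
      · have := hc.1 s
        by_cases hsx : s = x
        · subst hsx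
          simp only [Pi.add_apply, Pi.single_eq_same]
          omega
        · simpa [hsx] using this
      · rw [hc.2 s hs, Pi.add_apply, Pi.single_eq_of_ne (by rintro rfl; exact hs hx), add_zero]

lemma not_le_of_mem_cone {x : σ} :
    ∀ p ∈ cone (h + Pi.single x 1) u, ∀ q ∈ cone h (u.erase x), ¬ p ≤ q := by
  intro p hp q hq hpq
  have h1 := hp.1 x
  have h2 : p x ≤ q x := hpq x
  have h3 := hq.2 x (Finset.notMem_erase x u)
  simp only [Pi.add_apply, Pi.single_eq_same] at h1
  omega

end Cone

namespace ConeFiltration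

variable {σ : Type*} [Fintype σ] {M : Set (σ → ℕ)} {Q : Multiset (ℕ × ℕ)}

lemma exists_cone_subset (hM : ConeFiltration M Q) :
    ∀ c ∈ Q, ∃ (h : σ → ℕ) (u : Finset σ), cone h u ⊆ M ∧ c = (∑ s, h s, u.card) := by
  induction hM with
  | empty => simp
  | single h u =>
    intro c hc
    exact ⟨h, u, subset_rfl, by simpa using hc⟩
  | union _ _ _ _ ih1 ih2 =>
    intro c hc
    rcases Multiset.mem_add.1 hc with hc | hc
    · obtain ⟨h, u, h1, h2⟩ := ih1 c hc
      exact ⟨h, u, h1.trans Set.subset_union_left, h2⟩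
    · obtain ⟨h, u, h1, h2⟩ := ih2 c hc
      exact ⟨h, u, h1.trans Set.subset_union_right, h2⟩

/-- A cone of positive dimension may be split along one of its directions. -/
lemma split (hM : ConeFiltration M Q) {e k : ℕ} {R : Multiset (ℕ × ℕ)}
    (hQ : Q = (e, k + 1) ::ₘ R) : ConeFiltration M ((e + 1, k + 1) ::ₘ (e, k) ::ₘ R) := by
  classical
  induction hM generalizing R with
  | empty => exact absurd hQ.symm (Multiset.cons_ne_zero)
  | single h u =>
    rw [← Multiset.cons_zero, Multiset.cons_eq_cons] at hQ
    obtain ⟨h1, h2⟩ : (∑ s, h s, u.card) = (e, k + 1) ∧ R = 0 := by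
      rcases hQ with hQ | ⟨_, cs, h0, -⟩
      · exact ⟨hQ.1, hQ.2.symm⟩
      · exact absurd h0.symm Multiset.cons_ne_zero
    simp only [Prod.mk.injEq] at h1
    obtain ⟨x, hx⟩ : u.Nonempty := Finset.card_pos.1 (by omega)
    have key := ConeFiltration.union (.single (h + Pi.single x 1) u) (.single h (u.erase x))
      not_le_of_mem_cone (by rw [cone_union_cone hx]; exact ordConnected_cone h u)
    rw [cone_union_cone hx, Finset.card_erase_of_mem hx] at key
    simpa [Finset.sum_add_distrib, h1.1, h1.2, h2] using key
  | @union M₁ M₂ Q₁ Q₂ hM1 hM2 hlt hc ih1 ih2 =>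
    have hmem : (e, k + 1) ∈ Q₁ + Q₂ := by rw [hQ]; exact Multiset.mem_cons_self _ _
    rcases Multiset.mem_add.1 hmem with hm | hm
    · obtain ⟨R', rfl⟩ := Multiset.exists_cons_of_mem hm
      rw [Multiset.cons_add, Multiset.cons_inj_right] at hQ
      have := ConeFiltration.union (ih1 rfl) hM2 hlt hc
      rwa [Multiset.cons_add, Multiset.cons_add, hQ] at this
    · obtain ⟨R', rfl⟩ := Multiset.exists_cons_of_mem hm
      rw [Multiset.add_cons, Multiset.cons_inj_right] at hQ
      have := ConeFiltration.union hM1 (ih2 rfl) hlt hc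
      rwa [Multiset.add_cons, Multiset.add_cons, hQ] at this

/-- Full splitting of a cone: all pieces of positive dimension start one degree higher. -/
lemma split_all (e k : ℕ) {R : Multiset (ℕ × ℕ)} (hM : ConeFiltration M ((e, k) ::ₘ R)) :
    ∃ P : Multiset (ℕ × ℕ), ConeFiltration M (P + R) ∧
      (∀ c ∈ P, 0 < c.2 → c.1 = e + 1) ∧ (∀ c ∈ P, c.2 ≤ k) ∧ P.countP (·.2 = k) = 1 := by
  induction k generalizing R with
  | zero => exact ⟨{(e, 0)}, by simpa using hM, by simp, by simp, by simp [← Multiset.cons_zero]⟩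
  | succ k ih =>
    have h1 := hM.split rfl
    rw [Multiset.cons_swap] at h1
    obtain ⟨P, hP, hP1, hP2, -⟩ := ih h1
    refine ⟨(e + 1, k + 1) ::ₘ P, ?_, ?_, ?_, ?_⟩
    · rwa [Multiset.cons_add, ← Multiset.add_cons]
    · intro c hc
      rcases Multiset.mem_cons.1 hc with rfl | hc
      · simp
      · exact hP1 c hc
    · intro c hc
      rcases Multiset.mem_cons.1 hc with rfl | hc
      · simp
      · exact (hP2 c hc).trans (Nat.le_succ k)
    · rw [Multiset.countP_cons_of_pos P (p := (·.2 = k + 1)) rfl, Multiset.countP_eq_zero.2]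
      intro c hc
      have := hP2 c hc
      omega

lemma familyExact [DecidableEq σ] {k : Type*} [Field k] {n : ℕ} (g : Fin n ↪ σ) (c : σ → ℕ)
    (hc : ∀ s, s ∉ Set.range g → c s = 0) (i : ℕ) (hM : ConeFiltration M Q)
    (hQ : ∀ q ∈ Q, q.1 + i < ∑ s, c s) :
    FamilyExact k
      {F : Finset (Fin n) | ∃ p ∈ M, ∀ s, p s + (if s ∈ F.map g then 1 else 0) = c s} i := by
  induction hM with
  | empty => exact .of_forall_card_ne (by simp)
  | single h u =>
    by_cases hx : ∃ x, g x ∈ u ∧ h (g x) < c (g x)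
    · obtain ⟨x, hxu, hxc⟩ := hx
      refine .of_pairing i x fun G hG => ⟨?_, ?_⟩
      · rintro ⟨p, hp, hpc⟩
        refine ⟨p + Pi.single (g x) 1, ⟨fun s => ?_, fun s hs => ?_⟩, fun s => ?_⟩
        · have := hp.1 s
          simp only [Pi.add_apply]
          omega
        · rw [Pi.add_apply, hp.2 s hs, Pi.single_eq_of_ne (by rintro rfl; exact hs hxu), add_zero]
        · rw [← hpc s, Pi.add_apply]
          by_cases hs : s = g x
          · subst hs
            simp [hG]
          · simp [hs]
      · rintro ⟨p, hp, hpc⟩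
        refine ⟨fun s => p s - (Pi.single (g x) 1 : σ → ℕ) s,
          ⟨fun s => ?_, fun s hs => ?_⟩, fun s => ?_⟩
        · have := hp.1 s
          have h2 := hpc s
          by_cases hs : s = g x
          · subst hs
            simp only [Finset.mem_map', hG, if_false] at h2
            simp only [Pi.single_eq_same]
            omega
          · simpa [hs] using this
        · simp only [hp.2 s hs]
          rw [Pi.single_eq_of_ne (by rintro rfl; exact hs hxu), tsub_zero]
        · have h2 := hpc s
          by_cases hs : s = g x
          · subst hs
            simp only [Finset.mem_map', hG, if_false] at h2
            simp only [Pi.single_eq_same, Finset.mem_map', Finset.mem_insert_self, if_true]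
            omega
          · simpa [hs, Ne.symm hs] using h2
    · push Not at hx
      refine .of_forall_card_ne ?_
      rintro F ⟨p, hp, hpc⟩ hF
      have hph : p = h := by
        funext s
        by_cases hs : s ∈ u
        · have h1 := hp.1 s
          have h2 := hpc s
          by_cases hsr : s ∈ Set.range g
          · obtain ⟨x, rfl⟩ := hsr
            have := hx x hs
            split_ifs at h2 <;> omega
          · have := hc s hsr
            split_ifs at h2 <;> omega
        · exact hp.2 s hs
      subst hph
      have hsum := hQ _ (Multiset.mem_singleton_self _)
      rw [← Finset.sum_congr rfl fun s _ => hpc s, Finset.sum_add_distrib, Finset.sum_boole,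
        Finset.filter_mem_eq_inter, Finset.univ_inter, Finset.card_map, hF] at hsum
      simp at hsum
  | @union M₁ M₂ Q₁ Q₂ _ _ hlt hoc ih1 ih2 =>
    have hset : {F : Finset (Fin n) | ∃ p ∈ M₁ ∪ M₂,
        ∀ s, p s + (if s ∈ F.map g then 1 else 0) = c s} =
        {F | ∃ p ∈ M₁, ∀ s, p s + (if s ∈ F.map g then 1 else 0) = c s} ∪
        {F | ∃ p ∈ M₂, ∀ s, p s + (if s ∈ F.map g then 1 else 0) = c s} := by
      ext F
      simp only [Set.mem_union, Set.mem_ofPred_eq, or_and_right, exists_or]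
    have hanti : ∀ {F G : Finset (Fin n)} {p q : σ → ℕ}, G ⊆ F →
        (∀ s, p s + (if s ∈ F.map g then 1 else 0) = c s) →
        (∀ s, q s + (if s ∈ G.map g then 1 else 0) = c s) → p ≤ q := by
      intro F G p q hGF hp hq s
      have h1 := hp s
      have h2 := hq s
      by_cases hs : s ∈ G.map g
      · rw [if_pos (Finset.map_subset_map.2 hGF hs)] at h1
        rw [if_pos hs] at h2
        change p s ≤ q s
        omega
      · rw [if_neg hs] at h2
        change p s ≤ q s
        omega
    rw [hset]
    refine (ih1 fun q hq => hQ q (Multiset.mem_add.2 (Or.inl hq))).union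
      (ih2 fun q hq => hQ q (Multiset.mem_add.2 (Or.inr hq))) ?_ ?_
    · rintro F ⟨p, hp, hpc⟩ G ⟨q, hq, hqc⟩ hGF
      exact hlt p hp q hq (hanti hGF hpc hqc)
    · rw [← hset]
      refine ⟨?_⟩
      rintro F₁ ⟨p₁, hp₁, hpc₁⟩ F₃ ⟨p₃, hp₃, hpc₃⟩ F₂ ⟨h12, h23⟩
      have hle : ∀ s, (if s ∈ F₂.map g then 1 else 0) ≤ c s := by
        intro s
        have := hpc₃ s
        by_cases hs : s ∈ F₂.map g
        · rw [if_pos (Finset.map_subset_map.2 h23 hs)] at this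
          rw [if_pos hs]
          omega
        · rw [if_neg hs]
          omega
      have hpc₂ : ∀ s, (c s - if s ∈ F₂.map g then 1 else 0)
          + (if s ∈ F₂.map g then 1 else 0) = c s := fun s => Nat.sub_add_cancel (hle s)
      exact ⟨_, hoc.out hp₃ hp₁ ⟨hanti h23 hpc₃ hpc₂, hanti h12 hpc₂ hpc₁⟩, hpc₂⟩

end ConeFiltration

/-- Between `e` and the degree of any cone of positive dimension, the list `R` has in each degree a
cone of at least the same dimension. -/
def IsStandard (e : ℕ) (R : Multiset (ℕ × ℕ)) : Prop :=
  ∀ c ∈ R, 0 < c.2 → e ≤ c.1 ∧ ∀ e', e ≤ e' → e' ≤ c.1 → ∃ c' ∈ R, c'.1 = e' ∧ c.2 ≤ c'.2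

section Standard

variable {σ : Type*} {N : Set (σ → ℕ)}

/-- Membership in a lower set of exponents only depends on the exponents truncated at some `b`. -/
lemma IsLowerSet.exists_truncation [Finite σ] (hN : IsLowerSet N) :
    ∃ b : ℕ, ∀ p q : σ → ℕ, (∀ s, min (p s) b = min (q s) b) → (p ∈ N ↔ q ∈ N) := by
  have := Fintype.ofFinite σ
  have hfin : {c | Minimal (· ∈ Nᶜ) c}.Finite :=
    WellQuasiOrderedLE.finite_of_isAntichain (setOfPred_minimal_antichain _)
  refine ⟨hfin.toFinset.sup fun c => Finset.univ.sup c, ?_⟩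
  suffices H : ∀ p q : σ → ℕ, (∀ s, min (p s) (hfin.toFinset.sup fun c => Finset.univ.sup c)
      = min (q s) (hfin.toFinset.sup fun c => Finset.univ.sup c)) → p ∈ N → q ∈ N from
    fun p q h => ⟨H p q h, H q p fun s => (h s).symm⟩
  intro p q h hp
  by_contra hq
  obtain ⟨c, hcq, hc⟩ := exists_minimal_le_of_wellFoundedLT (· ∈ Nᶜ) q hq
  refine hc.1 (hN (fun s => ?_) hp)
  have h1 : c s ≤ q s := hcq s
  have h2 : c s ≤ hfin.toFinset.sup fun c => Finset.univ.sup c :=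
    (Finset.le_sup (f := c) (Finset.mem_univ s)).trans
      (Finset.le_sup (f := fun c : σ → ℕ => Finset.univ.sup c) (hfin.mem_toFinset.2 hc))
  have h3 := h s
  change c s ≤ p s
  omega

variable [Fintype σ]

lemma exists_standard_coneFiltration_inter (hN : IsLowerSet N) {b : ℕ}
    (hb : ∀ p q : σ → ℕ, (∀ s, min (p s) b = min (q s) b) → (p ∈ N ↔ q ∈ N))
    (h : σ → ℕ) (hh : h ∈ N) (u : Finset σ) :
    ∃ Q, ConeFiltration (N ∩ cone h u) Q ∧ IsStandard (∑ s, h s) Q ∧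
      ∃ k, (∑ s, h s, k) ∈ Q ∧ ∀ v ⊆ u, cone h v ⊆ N → v.card ≤ k := by
  classical
  induction hμ : u.card + ∑ s, (b - h s) using Nat.strong_induction_on generalizing h u with
  | _ μ ih =>
  by_cases hu : cone h u ⊆ N
  · refine ⟨_, by rw [Set.inter_eq_right.2 hu]; exact .single h u, ?_, u.card,
      Multiset.mem_singleton_self _, fun v hv _ => Finset.card_le_card hv⟩
    intro c hc _
    rw [Multiset.mem_singleton.1 hc]
    exact ⟨le_rfl, fun e' h1 h2 => ⟨_, Multiset.mem_singleton_self _, le_antisymm h1 h2, le_rfl⟩⟩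
  obtain ⟨v, hv, hvmax⟩ := Finset.exists_max_image
    (u.powerset.filter fun v => cone h v ⊆ N) Finset.card
    ⟨∅, by
      simp only [Finset.mem_filter, Finset.empty_mem_powerset, true_and]
      rintro c ⟨-, hc⟩
      rwa [show c = h from funext fun s => hc s (Finset.notMem_empty s)]⟩
  simp only [Finset.mem_filter, Finset.mem_powerset] at hv hvmax
  obtain ⟨x, hxu, hxv⟩ : ∃ x ∈ u, x ∉ v := by
    by_contra! H
    exact hu (by rw [Finset.Subset.antisymm H hv.1]; exact hv.2)
  have hxb : h x < b := by
    by_contra! hxb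
    have := hvmax (insert x v) ⟨Finset.insert_subset hxu hv.1, fun q hq => ?_⟩
    · rw [Finset.card_insert_of_notMem hxv] at this
      omega
    · rw [hb q (Function.update q x (h x)) fun s => ?_]
      · refine hv.2 ⟨fun s => ?_, fun s hs => ?_⟩
        · by_cases hsx : s = x
          · subst hsx; simp
          · simpa [hsx] using hq.1 s
        · by_cases hsx : s = x
          · subst hsx; simp
          · simpa [hsx] using hq.2 s (by simp [hsx, hs])
      · by_cases hsx : s = x
        · subst hsx
          have := hq.1 s
          rw [Function.update_self]
          omega
        · rw [Function.update_of_ne hsx]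
  obtain ⟨Q₂, hQ₂, hst₂, k, hk, hkmax⟩ := ih _ (by
    rw [Finset.card_erase_of_mem hxu]
    have := Finset.card_pos.2 ⟨x, hxu⟩
    omega) h hh (u.erase x) rfl
  have hvk : ∀ w ⊆ u, cone h w ⊆ N → w.card ≤ k := fun w hw hwN =>
    (hvmax w ⟨hw, hwN⟩).trans
      (hkmax v (fun s hs => Finset.mem_erase.2 ⟨by rintro rfl; exact hxv hs, hv.1 hs⟩) hv.2)
  obtain ⟨Q₁, hQ₁, hst₁⟩ : ∃ Q₁, ConeFiltration (N ∩ cone (h + Pi.single x 1) u) Q₁ ∧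
      IsStandard (∑ s, h s + 1) Q₁ := by
    by_cases hhx : h + Pi.single x 1 ∈ N
    · obtain ⟨Q₁, hQ₁, hst₁, -⟩ := ih _ (by
        rw [← hμ]
        refine Nat.add_lt_add_left (Finset.sum_lt_sum (fun s _ => ?_) ⟨x, Finset.mem_univ x, ?_⟩) _
        · exact Nat.sub_le_sub_left (by simp) _
        · simp only [Pi.add_apply, Pi.single_eq_same]
          omega) (h + Pi.single x 1) hhx u rfl
      exact ⟨Q₁, hQ₁, by simpa [Finset.sum_add_distrib] using hst₁⟩
    · refine ⟨0, ?_, fun c hc => absurd hc (Multiset.notMem_zero c)⟩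
      rw [show N ∩ cone (h + Pi.single x 1) u = ∅ from ?_]
      · exact .empty
      · exact Set.eq_empty_of_forall_notMem fun c hc => hhx (hN (fun s => hc.2.1 s) hc.1)
  have hunion : N ∩ cone (h + Pi.single x 1) u ∪ N ∩ cone h (u.erase x) = N ∩ cone h u := by
    rw [← Set.inter_union_distrib_left, cone_union_cone hxu]
  have hfil := ConeFiltration.union hQ₁ hQ₂
    (fun p hp q hq => not_le_of_mem_cone p hp.2 q hq.2)
    (by rw [hunion]; exact hN.ordConnected.inter (ordConnected_cone h u))
  rw [hunion] at hfil
  refine ⟨Q₁ + Q₂, hfil, ?_, k, Multiset.mem_add.2 (Or.inr hk), hvk⟩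
  intro c hc hc0
  rcases Multiset.mem_add.1 hc with hc1 | hc2
  · obtain ⟨h1, h2⟩ := hst₁ c hc1 hc0
    refine ⟨by omega, fun e' he he' => ?_⟩
    rcases he.eq_or_lt with rfl | he
    · refine ⟨_, Multiset.mem_add.2 (Or.inr hk), rfl, ?_⟩
      obtain ⟨g, w, hgw, rfl⟩ := hQ₁.exists_cone_subset c hc1
      have hg := (hgw (self_mem_cone g w)).2
      refine hvk w (fun s hs => ?_) fun q hq => ?_
      · by_contra hsu
        have h3 := (hgw (show g + Pi.single s 1 ∈ cone g w from ⟨fun t => by simp, fun t ht => by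
          simp [show t ≠ s by rintro rfl; exact ht hs]⟩)).2.2 s hsu
        have h4 := hg.2 s hsu
        simp only [Pi.add_apply, Pi.single_eq_same] at h3 h4
        omega
      · refine hN (a := fun s => g s + (q s - h s)) (fun s => ?_)
          (hgw ⟨fun s => ?_, fun s hs => ?_⟩).1
        · have h3 : (h + Pi.single x 1 : σ → ℕ) s ≤ g s := hg.1 s
          rw [Pi.add_apply] at h3
          change q s ≤ g s + (q s - h s)
          omega
        · exact Nat.le_add_right _ _
        · simp [hq.2 s hs]
    · obtain ⟨c', hc', h3⟩ := h2 e' he he'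
      exact ⟨c', Multiset.mem_add.2 (Or.inl hc'), h3⟩
  · obtain ⟨h1, h2⟩ := hst₂ c hc2 hc0
    refine ⟨h1, fun e' he he' => ?_⟩
    obtain ⟨c', hc', h3⟩ := h2 e' he he'
    exact ⟨c', Multiset.mem_add.2 (Or.inr hc'), h3⟩

lemma IsLowerSet.exists_standard_coneFiltration (hN : IsLowerSet N) :
    ∃ Q, ConeFiltration N Q ∧ IsStandard 0 Q := by
  obtain ⟨b, hb⟩ := hN.exists_truncation
  by_cases h0 : (0 : σ → ℕ) ∈ N
  · obtain ⟨Q, hQ, hst, -⟩ := exists_standard_coneFiltration_inter hN hb 0 h0 Finset.univ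
    have huniv : cone (0 : σ → ℕ) Finset.univ = Set.univ :=
      Set.eq_univ_of_forall fun c =>
        ⟨fun s => Nat.zero_le _, fun s hs => absurd (Finset.mem_univ s) hs⟩
    rw [huniv, Set.inter_univ] at hQ
    exact ⟨Q, hQ, by simpa using hst⟩
  · refine ⟨0, ?_, fun c hc => absurd hc (Multiset.notMem_zero c)⟩
    rw [show N = ∅ from Set.eq_empty_of_forall_notMem fun c hc =>
      h0 (hN (fun s => Nat.zero_le _) hc)]
    exact .empty

end Standard

namespace ConeFiltration

variable {σ : Type*} [Fintype σ] {M : Set (σ → ℕ)}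

/-- Full splitting of several cones whose vertices have the same degree. -/
lemma split_multiset (e k : ℕ) (L : Multiset (ℕ × ℕ)) {R : Multiset (ℕ × ℕ)}
    (hM : ConeFiltration M (L + R)) (hL : ∀ c ∈ L, c.1 = e ∧ c.2 ≤ k) :
    ∃ P : Multiset (ℕ × ℕ), ConeFiltration M (P + R) ∧
      (∀ c ∈ P, 0 < c.2 → c.1 = e + 1) ∧ (∀ c ∈ P, c.2 ≤ k) ∧
      P.countP (·.2 = k) = L.countP (·.2 = k) := by
  induction L using Multiset.induction_on generalizing R with
  | empty => exact ⟨0, hM, by simp, by simp, rfl⟩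
  | cons c L ih =>
    obtain ⟨c1, c2⟩ := c
    obtain ⟨rfl, hc2⟩ := hL _ (Multiset.mem_cons_self _ _)
    dsimp only at hc2 hL ih
    rw [Multiset.cons_add] at hM
    obtain ⟨P₁, hP₁, h1, h2, h3⟩ := hM.split_all
    rw [add_left_comm] at hP₁
    obtain ⟨P₂, hP₂, h4, h5, h6⟩ := ih hP₁ fun c hc => hL c (Multiset.mem_cons_of_mem hc)
    refine ⟨P₁ + P₂, by rwa [add_assoc, add_left_comm], ?_, ?_, ?_⟩
    · intro c hc
      rcases Multiset.mem_add.1 hc with hc | hc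
      exacts [h1 c hc, h4 c hc]
    · intro c hc
      rcases Multiset.mem_add.1 hc with hc | hc
      exacts [(h2 c hc).trans hc2, h5 c hc]
    · rw [Multiset.countP_add, h6]
      rcases hc2.eq_or_lt with rfl | hlt
      · rw [Multiset.countP_cons, if_pos rfl, h3, add_comm]
      · rw [Multiset.countP_cons, if_neg hlt.ne, Multiset.countP_eq_zero.2, add_comm]
        intro c hc
        exact ((h2 c hc).trans_lt hlt).ne

/-- The cones of top dimension can be arranged to have distinct consecutive degrees. -/
lemma exactify (k b c : ℕ) {D R : Multiset (ℕ × ℕ)} (hM : ConeFiltration M (D + R))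
    (hst : IsStandard b R) (hdim : ∀ q ∈ R, q.2 ≤ k + 1) (hc : R.countP (·.2 = k + 1) = c) :
    ∃ R', ConeFiltration M (D + (Multiset.range c).map (fun i => (b + i, k + 1)) + R') ∧
      IsStandard (b + c) R' ∧ ∀ q ∈ R', q.2 ≤ k := by
  induction c generalizing b D R with
  | zero =>
    refine ⟨R, by simpa using hM, hst, fun q hq => ?_⟩
    have h1 := Multiset.countP_eq_zero.1 hc q hq
    have h2 := hdim q hq
    omega
  | succ c ih =>
    obtain ⟨q, hq, hqk⟩ := Multiset.countP_pos.1 (by rw [hc]; omega : 0 < R.countP (·.2 = k + 1))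
    obtain ⟨hq1, hq2⟩ := hst q hq (by omega)
    obtain ⟨⟨_, k'⟩, hq', rfl, hq'k⟩ := hq2 b le_rfl hq1
    dsimp only at *
    obtain rfl : k' = k + 1 := le_antisymm (hdim _ hq') (by omega)
    rename_i b
    obtain ⟨R₀, rfl⟩ := Multiset.exists_cons_of_mem hq'
    have hcount := hc
    rw [Multiset.countP_cons, if_pos rfl, add_left_inj] at hcount
    have hsplit := Multiset.filter_add_not (fun q : ℕ × ℕ => q.1 = b) R₀
    rw [← hsplit, Multiset.add_cons, ← Multiset.cons_add, add_left_comm] at hM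
    obtain ⟨P, hP, hP1, hP2, hP3⟩ := hM.split_multiset b (k + 1) _ fun q hq =>
      ⟨(Multiset.mem_filter.1 hq).2,
        hdim q (Multiset.mem_cons_of_mem (Multiset.mem_filter.1 hq).1)⟩
    rw [add_left_comm] at hP
    have hst' : IsStandard (b + 1) (P + R₀.filter fun q => ¬ q.1 = b) := by
      intro q hq hq0
      rcases Multiset.mem_add.1 hq with hq | hq
      · have h1 := hP1 q hq hq0
        exact ⟨h1.ge, fun e' h2 h3 => ⟨q, Multiset.mem_add.2 (Or.inl hq), by omega, le_rfl⟩⟩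
      · obtain ⟨hq1, hqb⟩ := Multiset.mem_filter.1 hq
        obtain ⟨h1, h2⟩ := hst q (Multiset.mem_cons_of_mem hq1) hq0
        refine ⟨by omega, fun e' h3 h4 => ?_⟩
        obtain ⟨q', hq', h5, h6⟩ := h2 e' (by omega) h4
        refine ⟨q', Multiset.mem_add.2 (Or.inr (Multiset.mem_filter.2 ⟨?_, by omega⟩)), h5, h6⟩
        refine (Multiset.mem_cons.1 hq').resolve_left ?_
        rintro rfl
        dsimp only at h5
        omega
    obtain ⟨R', hR', hR'st, hR'k⟩ := ih (b + 1) hP hst' (fun q hq => by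
      rcases Multiset.mem_add.1 hq with hq | hq
      exacts [hP2 q hq, hdim q (Multiset.mem_cons_of_mem (Multiset.mem_filter.1 hq).1)])
      (by rw [Multiset.countP_add, hP3, ← Multiset.countP_add, hsplit, hcount])
    refine ⟨R', ?_, by rwa [← add_assoc, add_right_comm], hR'k⟩
    convert hR' using 2
    rw [← Multiset.coe_range, ← Multiset.coe_range, Multiset.map_coe, Multiset.map_coe,
      List.range_succ_eq_map, List.map_cons, List.map_map, ← Multiset.cons_coe,
      Multiset.add_cons, Multiset.cons_add]
    congr 3
    refine List.map_congr_left fun i _ => ?_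
    simp only [Function.comp_apply, Prod.mk.injEq, and_true]
    exact (Nat.succ_add_eq_add_succ b i).symm

end ConeFiltration

namespace Polynomial

/-- The Hilbert series of a sum of cones listed in `R`, multiplied by `(1 - X) ^ k`. -/
noncomputable def conePolynomial (k : ℕ) (R : Multiset (ℕ × ℕ)) : ℤ[X] :=
  (R.map fun c => X ^ c.1 * (1 - X) ^ (k - c.2)).sum

lemma conePolynomial_add (k : ℕ) (R S : Multiset (ℕ × ℕ)) :
    conePolynomial k (R + S) = conePolynomial k R + conePolynomial k S := by
  simp [conePolynomial]

lemma conePolynomial_cons (k : ℕ) (c : ℕ × ℕ) (R : Multiset (ℕ × ℕ)) :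
    conePolynomial k (c ::ₘ R) = X ^ c.1 * (1 - X) ^ (k - c.2) + conePolynomial k R := by
  simp [conePolynomial]

lemma conePolynomial_succ {k : ℕ} {R : Multiset (ℕ × ℕ)} (hR : ∀ q ∈ R, q.2 ≤ k) :
    conePolynomial (k + 1) R = (1 - X) * conePolynomial k R := by
  induction R using Multiset.induction_on with
  | empty => simp [conePolynomial]
  | cons c R ih =>
    rw [conePolynomial_cons, conePolynomial_cons, ih fun q hq => hR q (Multiset.mem_cons_of_mem hq),
      Nat.sub_add_comm (hR c (Multiset.mem_cons_self c R)), pow_succ]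
    ring

lemma eval_one_conePolynomial {k : ℕ} {R : Multiset (ℕ × ℕ)} (hR : ∀ q ∈ R, q.2 ≤ k) :
    (conePolynomial k R).eval 1 = R.countP (·.2 = k) := by
  induction R using Multiset.induction_on with
  | empty => simp [conePolynomial]
  | cons c R ih =>
    rw [conePolynomial_cons, eval_add, ih fun q hq => hR q (Multiset.mem_cons_of_mem hq)]
    have := hR c (Multiset.mem_cons_self c R)
    by_cases h : c.2 = k
    · rw [Multiset.countP_cons, if_pos h]
      simp [h, add_comm]
    · rw [Multiset.countP_cons, if_neg h]
      simp [show k - c.2 ≠ 0 by omega]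

lemma conePolynomial_map_range (k b c : ℕ) :
    conePolynomial k ((Multiset.range c).map fun i => (b + i, k))
      = ∑ i ∈ Finset.range c, X ^ (b + i) := by
  simp [conePolynomial, Finset.sum]

lemma coeff_conePolynomial_zero (R : Multiset (ℕ × ℕ)) (i : ℕ) :
    (conePolynomial 0 R).coeff i = R.countP (·.1 = i) := by
  induction R using Multiset.induction_on with
  | empty => simp [conePolynomial]
  | cons c R ih =>
    rw [conePolynomial_cons, coeff_add, ih, Multiset.countP_cons, zero_tsub, pow_zero, mul_one,
      coeff_X_pow]
    simp only [eq_comm (a := i)]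
    push_cast
    ring

lemma dim_le_of_conePolynomial_eq {m n : ℕ} {R : Multiset (ℕ × ℕ)} {g : ℤ[X]}
    (hR : ∀ q ∈ R, q.2 ≤ m + n) (h : conePolynomial (m + n) R = (1 - X) ^ n * g) :
    (∀ q ∈ R, q.2 ≤ m) ∧ conePolynomial m R = g := by
  induction n with
  | zero => exact ⟨hR, by simpa using h⟩
  | succ n ih =>
    rw [← add_assoc] at h hR
    have h0 : R.countP (·.2 = m + n + 1) = 0 := by
      have := eval_one_conePolynomial hR
      rw [h] at this
      simpa using this.symm
    have hR' : ∀ q ∈ R, q.2 ≤ m + n := fun q hq => by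
      have h1 := Multiset.countP_eq_zero.1 h0 q hq
      have h2 := hR q hq
      omega
    refine ih hR' (mul_left_cancel₀ (a := 1 - X) ?_ ?_)
    · exact fun h1 => by simpa using congrArg (eval 0) h1
    · rw [← conePolynomial_succ hR', h, pow_succ]
      ring

lemma coeff_of_one_sub_X_mul_eq {g h : ℤ[X]} (hg : (1 - X) * g = h) (i : ℕ) :
    g.coeff i = ∑ j ∈ Finset.range (i + 1), h.coeff j := by
  subst hg
  induction i with
  | zero => simp [sub_mul]
  | succ i ih =>
    rw [Finset.sum_range_succ, ← ih, sub_mul, one_mul, coeff_sub, coeff_X_mul]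
    ring

lemma eval_one_of_one_sub_X_mul_eq {g h : ℤ[X]} (hg : (1 - X) * g = h) :
    g.eval 1 = - h.derivative.eval 1 := by
  subst hg
  simp [derivative_mul]

lemma eval_one_eq_sum_coeff {g : ℤ[X]} {N : ℕ} (hg : ∀ i, N ≤ i → g.coeff i = 0) :
    g.eval 1 = ∑ j ∈ Finset.range N, g.coeff j := by
  rw [eval_eq_sum_range' (n := max N (g.natDegree + 1)) (by omega)]
  simp only [one_pow, mul_one]
  symm
  refine Finset.sum_subset (Finset.range_mono (le_max_left _ _)) fun i _ hi => hg i ?_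
  simpa using hi

/-- The numerical information on the polynomial of a standard filtration in stage `b`. -/
def IsNumericallyBounded (b : ℕ) (g : ℤ[X]) : Prop :=
  (∀ i, 0 ≤ g.coeff i) ∧ (∀ i, b ≤ i → g.coeff i = 0) ∧ 2 * g.eval 1 ≤ b * (b - 1)

lemma sum_coeff_sum_X_pow (b c i : ℕ) :
    ∑ j ∈ Finset.range (i + 1), (∑ l ∈ Finset.range c, (X : ℤ[X]) ^ (b + l)).coeff j
      = (min (i + 1 - b) c : ℕ) := by
  induction c with
  | zero => simp
  | succ c ih =>
    simp only [Finset.sum_range_succ (n := c), coeff_add, Finset.sum_add_distrib, ih, coeff_X_pow,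
      Finset.sum_ite_eq', Finset.mem_range]
    split_ifs <;> push_cast <;> omega

lemma IsNumericallyBounded.of_one_sub_X_mul_eq {b c : ℕ} {g g' : ℤ[X]}
    (h0 : ∀ i, 0 ≤ g.coeff i) (hdeg : ∀ i, b + c ≤ i → g.coeff i = 0) (hc : g.eval 1 = c)
    (hsum : ∀ i, ((min (i + 1 - b) c : ℕ) : ℤ) ≤ ∑ j ∈ Finset.range (i + 1), g.coeff j)
    (hg' : (1 - X) * g' = g - ∑ i ∈ Finset.range c, X ^ (b + i)) :
    IsNumericallyBounded (b + c) g' := by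
  have hcoeff : ∀ i, g'.coeff i
      = ∑ j ∈ Finset.range (i + 1), g.coeff j - (min (i + 1 - b) c : ℕ) := fun i => by
    rw [coeff_of_one_sub_X_mul_eq hg', ← sum_coeff_sum_X_pow, ← Finset.sum_sub_distrib]
    simp only [coeff_sub]
  refine ⟨fun i => ?_, fun i hi => ?_, ?_⟩
  · rw [hcoeff]
    exact sub_nonneg.2 (hsum i)
  · rw [hcoeff, ← eval_one_eq_sum_coeff fun j hj => hdeg j (by omega), hc]
    omega
  · have hder : 0 ≤ g.derivative.eval 1 := by
      rw [eval_eq_sum_range]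
      refine Finset.sum_nonneg fun i _ => ?_
      rw [coeff_derivative, one_pow, mul_one]
      exact mul_nonneg (h0 _) (by positivity)
    have hsq : ∀ c : ℕ, 2 * (∑ i ∈ Finset.range c, (X : ℤ[X]) ^ (b + i)).derivative.eval 1
        = ((b + c : ℕ) : ℤ) * ((b + c : ℕ) - 1) - b * (b - 1) := fun c => by
      induction c with
      | zero => simp
      | succ c ih =>
        rw [Finset.sum_range_succ, derivative_add, eval_add, mul_add, ih]
        simp [derivative_X_pow]
        ring
    rw [eval_one_of_one_sub_X_mul_eq hg', derivative_sub, eval_sub]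
    have hb : (0 : ℤ) ≤ b * (b - 1) := by
      rcases Nat.eq_zero_or_pos b with rfl | hb
      · simp
      · exact mul_nonneg (by positivity) (by omega)
    linarith [hsq c]

variable {σ : Type*} [Fintype σ]

/-- The Hilbert series of the space spanned by the monomials with exponents in `M`. -/
noncomputable def hilbertSeries (M : Set (σ → ℕ)) : PowerSeries ℤ :=
  .mk fun t => ({c ∈ M | ∑ s, c s = t}.ncard : ℤ)

lemma finite_setOf_mem_sum_eq (M : Set (σ → ℕ)) (t : ℕ) : {c ∈ M | ∑ s, c s = t}.Finite := by
  classical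
  refine (Set.finite_Iic fun _ : σ => t).subset ?_
  rintro c ⟨-, rfl⟩ s
  exact Finset.single_le_sum (fun _ _ => Nat.zero_le _) (Finset.mem_univ s)

lemma hilbertSeries_union {M₁ M₂ : Set (σ → ℕ)} (h : Disjoint M₁ M₂) :
    hilbertSeries (M₁ ∪ M₂) = hilbertSeries M₁ + hilbertSeries M₂ := by
  ext t
  simp only [hilbertSeries, PowerSeries.coeff_mk, map_add]
  rw [← Nat.cast_add, ← Set.ncard_union_eq _ (finite_setOf_mem_sum_eq _ _)
    (finite_setOf_mem_sum_eq _ _)]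
  · congr 2
    ext c
    simp only [Set.mem_union, Set.mem_ofPred_eq, or_and_right]
  · exact h.mono (fun c hc => hc.1) (fun c hc => hc.1)

lemma hilbertSeries_cone_add_single [DecidableEq σ] (h : σ → ℕ) (u : Finset σ) (x : σ) :
    hilbertSeries (cone (h + Pi.single x 1) u) = PowerSeries.X * hilbertSeries (cone h u) := by
  have hmem : ∀ c, c + Pi.single x 1 ∈ cone (h + Pi.single x 1) u ↔ c ∈ cone h u := fun c => by
    simp [cone]
  ext t
  cases t with
  | zero =>
    rw [PowerSeries.coeff_zero_X_mul, hilbertSeries, PowerSeries.coeff_mk, Nat.cast_eq_zero,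
      Set.ncard_eq_zero (finite_setOf_mem_sum_eq _ _)]
    refine Set.eq_empty_of_forall_notMem fun c hc => ?_
    have h1 := hc.1.1 x
    have h2 := Finset.sum_eq_zero_iff.1 hc.2 x (Finset.mem_univ x)
    simp [h2] at h1
  | succ t =>
    rw [PowerSeries.coeff_succ_X_mul, hilbertSeries, hilbertSeries, PowerSeries.coeff_mk,
      PowerSeries.coeff_mk, ← Set.ncard_image_of_injective {c ∈ cone h u | ∑ s, c s = t}
        (add_left_injective (Pi.single x 1 : σ → ℕ))]
    congr 2
    ext c
    constructor
    · rintro ⟨hc, hct⟩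
      have hx : Pi.single x 1 ≤ c := fun s => by
        have := hc.1 s
        simp only [Pi.add_apply] at this
        change (Pi.single x 1 : σ → ℕ) s ≤ c s
        omega
      refine ⟨c - Pi.single x 1, ⟨?_, ?_⟩, tsub_add_cancel_of_le hx⟩
      · rw [← hmem, tsub_add_cancel_of_le hx]
        exact hc
      · rw [← tsub_add_cancel_of_le hx] at hct
        simpa [Finset.sum_add_distrib] using hct
    · rintro ⟨c, ⟨hc, hct⟩, rfl⟩
      refine ⟨(hmem c).2 hc, ?_⟩
      simpa [Finset.sum_add_distrib] using hct

lemma one_sub_X_pow_mul_hilbertSeries_cone (h : σ → ℕ) (u : Finset σ) :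
    (1 - PowerSeries.X) ^ u.card * hilbertSeries (cone h u) = PowerSeries.X ^ (∑ s, h s) := by
  classical
  induction u using Finset.induction_on with
  | empty =>
    rw [Finset.card_empty, pow_zero, one_mul]
    have : cone h ∅ = {h} := by
      ext c
      constructor
      · rintro ⟨-, hc⟩
        exact _root_.funext fun s => hc s (Finset.notMem_empty s)
      · rintro rfl
        exact self_mem_cone c ∅
    ext t
    rw [this, hilbertSeries, PowerSeries.coeff_mk, PowerSeries.coeff_X_pow]
    split_ifs with ht
    · rw [show {c ∈ ({h} : Set (σ → ℕ)) | ∑ s, c s = t} = {h} from ?_]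
      · simp
      · ext c
        simp only [Set.mem_singleton_iff, Set.mem_ofPred_eq, and_iff_left_iff_imp]
        rintro rfl
        exact ht.symm
    · rw [Nat.cast_eq_zero, Set.ncard_eq_zero (finite_setOf_mem_sum_eq _ _)]
      refine Set.eq_empty_of_forall_notMem ?_
      rintro c ⟨rfl, hc⟩
      exact ht hc.symm
  | insert x u hx ih =>
    have hsplit : hilbertSeries (cone h (insert x u))
        = PowerSeries.X * hilbertSeries (cone h (insert x u)) + hilbertSeries (cone h u) := by
      rw [← hilbertSeries_cone_add_single h _ x, ← hilbertSeries_union]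
      · conv_rhs => rw [show u = (insert x u).erase x by rw [Finset.erase_insert hx]]
        rw [Finset.insert_erase (Finset.mem_insert_self x u),
          cone_union_cone (Finset.mem_insert_self x u)]
      · rw [← Finset.erase_insert hx]
        conv_lhs => rw [Finset.erase_insert hx]
        exact Set.disjoint_left.2 fun c h1 h2 => not_le_of_mem_cone c h1 c h2 le_rfl
    rw [Finset.card_insert_of_notMem hx, pow_succ, ← ih]
    linear_combination (1 - PowerSeries.X) ^ u.card * hsplit

lemma _root_.ConeFiltration.one_sub_X_pow_mul_hilbertSeries {M : Set (σ → ℕ)}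
    {Q : Multiset (ℕ × ℕ)} (hM : ConeFiltration M Q) :
    (1 - PowerSeries.X) ^ Fintype.card σ * hilbertSeries M
      = (conePolynomial (Fintype.card σ) Q : PowerSeries ℤ) := by
  induction hM with
  | empty =>
    have : hilbertSeries (∅ : Set (σ → ℕ)) = 0 := by
      ext t
      simp [hilbertSeries]
    simp [this, conePolynomial]
  | single h u =>
    rw [← Multiset.cons_zero, conePolynomial_cons]
    have hu := Nat.sub_add_cancel (Finset.card_le_univ u)
    conv_lhs => rw [← hu, pow_add, mul_assoc, one_sub_X_pow_mul_hilbertSeries_cone]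
    simp [conePolynomial, mul_comm]
  | union _ _ hlt _ ih1 ih2 =>
    rw [hilbertSeries_union (Set.disjoint_left.2 fun c h1 h2 => hlt c h1 c h2 le_rfl), mul_add,
      ih1, ih2, conePolynomial_add, coe_add]

lemma _root_.ConeFiltration.conePolynomial_eq {M : Set (σ → ℕ)} {Q Q' : Multiset (ℕ × ℕ)}
    (hM : ConeFiltration M Q) (hM' : ConeFiltration M Q') :
    conePolynomial (Fintype.card σ) Q = conePolynomial (Fintype.card σ) Q' :=
  coe_injective _ (hM.one_sub_X_pow_mul_hilbertSeries.symm.trans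
    hM'.one_sub_X_pow_mul_hilbertSeries)

lemma _root_.ConeFiltration.dim_le {M : Set (σ → ℕ)} {Q : Multiset (ℕ × ℕ)}
    (hM : ConeFiltration M Q) : ∀ q ∈ Q, q.2 ≤ Fintype.card σ := by
  intro q hq
  obtain ⟨h, u, -, rfl⟩ := hM.exists_cone_subset q hq
  exact Finset.card_le_univ u

lemma conePolynomial_add_left {k : ℕ} {R : Multiset (ℕ × ℕ)} (hR : ∀ q ∈ R, q.2 ≤ k) (l : ℕ) :
    conePolynomial (k + l) R = (1 - X) ^ l * conePolynomial k R := by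
  induction l with
  | zero => simp
  | succ l ih =>
    rw [← add_assoc, conePolynomial_succ fun q hq => (hR q hq).trans (Nat.le_add_right k l), ih,
      pow_succ]
    ring

lemma one_sub_X_ne_zero : (1 - X : ℤ[X]) ≠ 0 := fun h => by
  simpa using congrArg (eval 0) h

variable {M : Set (σ → ℕ)}

/-- One elimination step: the cones of dimension `k + 1` become exact, the rest starts later. -/
lemma _root_.ConeFiltration.exists_isNumericallyBounded {k b c : ℕ} {D R : Multiset (ℕ × ℕ)}
    (hM : ConeFiltration M (D + R)) (hD : ∀ q ∈ D, q.1 < b) (hst : IsStandard b R)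
    (hdim : ∀ q ∈ R, q.2 ≤ k + 1) (hk : k + 1 ≤ Fintype.card σ)
    (h0 : ∀ i, 0 ≤ (conePolynomial (k + 1) R).coeff i)
    (hdeg : ∀ i, b + c ≤ i → (conePolynomial (k + 1) R).coeff i = 0)
    (hc : (conePolynomial (k + 1) R).eval 1 = c)
    (hsum : ∀ i, ((min (i + 1 - b) c : ℕ) : ℤ) ≤
      ∑ j ∈ Finset.range (i + 1), (conePolynomial (k + 1) R).coeff j) :
    ∃ D' R', ConeFiltration M (D' + R') ∧ (∀ q ∈ D', q.1 < b + c) ∧ IsStandard (b + c) R' ∧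
      (∀ q ∈ R', q.2 ≤ k) ∧ IsNumericallyBounded (b + c) (conePolynomial k R') := by
  obtain ⟨R', hR', hst', hdim'⟩ := hM.exactify k b c hst hdim (by
    exact_mod_cast (eval_one_conePolynomial hdim).symm.trans hc)
  refine ⟨_, R', hR', fun q hq => ?_, hst', hdim', .of_one_sub_X_mul_eq h0 hdeg hc hsum ?_⟩
  · rcases Multiset.mem_add.1 hq with hq | hq
    · exact (hD q hq).trans_le (Nat.le_add_right b c)
    · obtain ⟨i, hi, rfl⟩ := Multiset.mem_map.1 hq
      exact Nat.add_lt_add_left (Multiset.mem_range.1 hi) b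
  · have hdim'' : ∀ q ∈ (Multiset.range c).map (fun i => (b + i, k + 1)) + R', q.2 ≤ k + 1 := by
      intro q hq
      rcases Multiset.mem_add.1 hq with hq | hq
      · obtain ⟨i, -, rfl⟩ := Multiset.mem_map.1 hq
        exact le_rfl
      · exact (hdim' q hq).trans (Nat.le_succ k)
    have heq := hM.conePolynomial_eq hR'
    rw [← Nat.add_sub_cancel' hk, add_assoc D, conePolynomial_add, conePolynomial_add _ D,
      add_right_inj, conePolynomial_add_left hdim, conePolynomial_add_left hdim''] at heq
    rw [mul_left_cancel₀ (pow_ne_zero _ one_sub_X_ne_zero) heq, conePolynomial_add,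
      conePolynomial_map_range, conePolynomial_succ hdim']
    ring

lemma _root_.ConeFiltration.exists_forall_lt_of_coeff {b : ℕ} {D R : Multiset (ℕ × ℕ)}
    (hM : ConeFiltration M (D + R)) (hD : ∀ q ∈ D, q.1 < b)
    (hR : ∀ i, b ≤ i → (conePolynomial 0 R).coeff i = 0) :
    ∃ Q, ConeFiltration M Q ∧ ∀ q ∈ Q, q.1 < b := by
  refine ⟨_, hM, fun q hq => ?_⟩
  rcases Multiset.mem_add.1 hq with hq | hq
  · exact hD q hq
  · by_contra! h
    have h1 := hR _ h
    rw [coeff_conePolynomial_zero, Nat.cast_eq_zero] at h1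
    exact Multiset.countP_eq_zero.1 h1 q hq rfl

lemma _root_.ConeFiltration.exists_forall_lt_pow {k b : ℕ} {D R : Multiset (ℕ × ℕ)}
    (hM : ConeFiltration M (D + R)) (hD : ∀ q ∈ D, q.1 < b) (hst : IsStandard b R)
    (hdim : ∀ q ∈ R, q.2 ≤ k) (hk : k ≤ Fintype.card σ)
    (hb : IsNumericallyBounded b (conePolynomial k R)) :
    ∃ Q, ConeFiltration M Q ∧ ∀ q ∈ Q, q.1 < b ^ 2 ^ k := by
  induction k generalizing b D R with
  | zero => simpa using hM.exists_forall_lt_of_coeff hD hb.2.1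
  | succ k ih =>
    obtain ⟨h0, hdeg, hbd⟩ := hb
    have hsum := eval_one_eq_sum_coeff hdeg
    obtain ⟨c, hc⟩ := Int.eq_ofNat_of_zero_le (a := (conePolynomial (k + 1) R).eval 1) (by
      rw [hsum]
      exact Finset.sum_nonneg fun i _ => h0 i)
    obtain ⟨D', R', hM', hD', hst', hdim', hb'⟩ := hM.exists_isNumericallyBounded (c := c) hD hst
      hdim hk h0 (fun i hi => hdeg i (by omega)) hc (fun i => by
        rcases le_or_gt (i + 1) b with hi | hi
        · rw [Nat.sub_eq_zero_of_le hi, Nat.zero_min]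
          exact Finset.sum_nonneg fun i _ => h0 i
        · rw [← eval_one_eq_sum_coeff fun j hj => hdeg j (by omega), hc]
          exact_mod_cast min_le_right _ _)
    obtain ⟨Q, hQ, hQb⟩ := ih hM' hD' hst' hdim' (by omega) hb'
    refine ⟨Q, hQ, fun q hq => (hQb q hq).trans_le ?_⟩
    rw [pow_succ', pow_mul]
    refine Nat.pow_le_pow_left ?_ _
    rw [hc] at hbd
    zify
    rcases Nat.eq_zero_or_pos b with rfl | hb
    · simp at hbd ⊢
      omega
    · nlinarith [(by exact_mod_cast hb : (1 : ℤ) ≤ b)]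

/-- The number of vectors in `[0, d) ^ n` with a given sum of coordinates, as a polynomial. -/
lemma coeff_geom_sum_pow (d n : ℕ) (hd : 0 < d) :
    (∀ i, 0 ≤ ((∑ i ∈ Finset.range d, (X : ℤ[X]) ^ i) ^ n).coeff i) ∧
    (∀ i, i ≤ n * (d - 1) → 0 < ((∑ i ∈ Finset.range d, (X : ℤ[X]) ^ i) ^ n).coeff i) ∧
    ∀ i, n * (d - 1) < i → ((∑ i ∈ Finset.range d, (X : ℤ[X]) ^ i) ^ n).coeff i = 0 := by
  induction n with
  | zero =>
    simp only [pow_zero, coeff_one]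
    refine ⟨fun i => by split_ifs <;> simp, fun i hi => ?_, fun i hi => if_neg (by omega)⟩
    rw [if_pos (by omega)]
    exact one_pos
  | succ n ih =>
    obtain ⟨h0, h1, h2⟩ := ih
    have hcoeff : ∀ i, ((∑ i ∈ Finset.range d, (X : ℤ[X]) ^ i) ^ (n + 1)).coeff i
        = ∑ l ∈ Finset.range d, if l ≤ i then
          ((∑ i ∈ Finset.range d, (X : ℤ[X]) ^ i) ^ n).coeff (i - l) else 0 := fun i => by
      rw [pow_succ, Finset.mul_sum, finsetSum_coeff]
      exact Finset.sum_congr rfl fun l _ => coeff_mul_X_pow' _ _ _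
    have hnn : ∀ i, ∀ l ∈ Finset.range d, 0 ≤ if l ≤ i then
          ((∑ i ∈ Finset.range d, (X : ℤ[X]) ^ i) ^ n).coeff (i - l) else 0 := fun i l _ => by
      split_ifs
      exacts [h0 _, le_rfl]
    rw [Nat.succ_mul]
    refine ⟨fun i => ?_, fun i hi => ?_, fun i hi => ?_⟩
    · rw [hcoeff]
      exact Finset.sum_nonneg (hnn i)
    · rw [hcoeff]
      refine Finset.sum_pos' (hnn i) ⟨min i (d - 1), ?_, ?_⟩
      · rw [Finset.mem_range]
        omega
      · rw [if_pos (min_le_left _ _)]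
        exact h1 _ (by omega)
    · rw [hcoeff]
      refine Finset.sum_eq_zero fun l hl => ?_
      rw [Finset.mem_range] at hl
      split_ifs
      · exact h2 _ (by omega)
      · rfl

lemma _root_.ConeFiltration.exists_forall_lt_pow_of_isStandard {m n d : ℕ} (hd : 0 < d)
    {Q : Multiset (ℕ × ℕ)} (hM : ConeFiltration M Q) (hst : IsStandard 0 Q)
    (hV : Fintype.card σ = m + n)
    (hg : conePolynomial (m + n) Q = (1 - X) ^ n * (∑ i ∈ Finset.range d, X ^ i) ^ n) :
    ∃ Q', ConeFiltration M Q' ∧ ∀ q ∈ Q', q.1 < (d ^ n) ^ 2 ^ (m - 1) := by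
  obtain ⟨hdim, hg⟩ := dim_le_of_conePolynomial_eq (fun q hq => hV ▸ hM.dim_le q hq) hg
  obtain ⟨h0, h1, h2⟩ := coeff_geom_sum_pow d n hd
  have hlt : n * (d - 1) < d ^ n := by
    have := one_add_mul_le_pow (a := (d - 1 : ℤ)) (by omega) n
    rw [add_sub_cancel] at this
    zify [Nat.succ_le_iff.2 hd]
    linarith
  rw [← hg] at h0 h1 h2
  have hdeg : ∀ i, 0 + d ^ n ≤ i → (conePolynomial m Q).coeff i = 0 := fun i hi =>
    h2 i (by omega)
  have hM' : ConeFiltration M (0 + Q) := by rwa [zero_add]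
  cases m with
  | zero => simpa using hM'.exists_forall_lt_of_coeff (by simp) hdeg
  | succ m =>
    have hone : (conePolynomial (m + 1) Q).eval 1 = (d ^ n : ℕ) := by
      rw [hg]
      simp [eval_pow, eval_finsetSum]
    obtain ⟨D', R', hM', hD', hst', hdim', hb'⟩ := hM'.exists_isNumericallyBounded (c := d ^ n)
      (by simp) hst hdim (by omega) h0 hdeg hone (fun i => by
        rcases le_or_gt i (n * (d - 1)) with hi | hi
        · calc ((min (i + 1 - 0) (d ^ n) : ℕ) : ℤ) ≤ (i + 1 : ℕ) := by
                exact_mod_cast min_le_left _ _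
            _ = ∑ j ∈ Finset.range (i + 1), 1 := by simp
            _ ≤ _ := Finset.sum_le_sum fun j hj => h1 j (by
                have := Finset.mem_range.1 hj
                omega)
        · rw [← eval_one_eq_sum_coeff fun j hj => h2 j (by omega), hone]
          exact_mod_cast min_le_right _ _)
    rw [zero_add] at hD' hst' hb'
    exact hM'.exists_forall_lt_pow hD' hst' hdim' (by omega) hb'

end Polynomial

/-- The indices `c` for which `x c` is not a linear combination of the vectors of the same degree
with a smaller key. -/
def standardIndices (K : Type*) {ι Γ T : Type*} [Field K] [AddCommGroup T] [Module K T]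
    [Preorder Γ] (x : ι → T) (deg : ι → ℕ) (κ : ι → Γ) : Set ι :=
  {c | x c ∉ Submodule.span K (x '' {c' | κ c' < κ c ∧ deg c' = deg c})}

section Standard

variable {k ι Γ T : Type*} [Field k]

lemma finrank_span_insert_of_notMem [AddCommGroup T] [Module k T] {v : T} {s : Set T}
    (hs : s.Finite) (hv : v ∉ Submodule.span k s) :
    Module.finrank k (Submodule.span k (insert v s))
      = Module.finrank k (Submodule.span k s) + 1 := by
  have := hs.to_subtype
  have hv0 : v ≠ 0 := by
    rintro rfl
    exact hv (zero_mem _)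
  have hfs : FiniteDimensional k (Submodule.span k s) := FiniteDimensional.span_of_finite k hs
  have hinf : Submodule.span k {v} ⊓ Submodule.span k s = ⊥ :=
    disjoint_iff.1 ((Submodule.disjoint_span_singleton' hv0).2 hv).symm
  have h := Submodule.finrank_sup_add_finrank_inf_eq (Submodule.span k {v}) (Submodule.span k s)
  rw [hinf, finrank_bot, add_zero, ← Submodule.span_union, finrank_span_singleton hv0] at h
  rw [Set.insert_eq, h, add_comm]

open scoped Classical in
lemma finrank_span_image_eq_card [AddCommGroup T] [Module k T] [LinearOrder Γ] (x : ι → T)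
    {κ : ι → Γ} (hκ : Function.Injective κ) (s : Finset ι) :
    Module.finrank k (Submodule.span k (x '' s))
      = (s.filter fun c => x c ∉ Submodule.span k (x '' {c' | κ c' < κ c ∧ c' ∈ s})).card := by
  classical
  induction s using Finset.induction_on_max_value κ with
  | empty =>
    rw [Finset.coe_empty, Set.image_empty, Submodule.span_empty, finrank_bot, Finset.filter_empty,
      Finset.card_empty]
  | insert a s has hmax ih =>
    have hlt : ∀ c ∈ s, κ c < κ a := fun c hc =>
      (hmax c hc).lt_of_ne fun h => has (hκ h ▸ hc)
    have ha : {c' | κ c' < κ a ∧ c' ∈ insert a s} = s := by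
      ext c
      simp only [Finset.mem_insert, Set.mem_ofPred_eq, Finset.mem_coe]
      constructor
      · rintro ⟨h, rfl | h'⟩
        exacts [absurd h (lt_irrefl _), h']
      · exact fun h => ⟨hlt c h, Or.inr h⟩
    have hs : ∀ c ∈ s, {c' | κ c' < κ c ∧ c' ∈ insert a s} = {c' | κ c' < κ c ∧ c' ∈ s} := by
      intro c hc
      ext c'
      simp only [Finset.mem_insert, Set.mem_ofPred_eq, and_congr_right_iff, or_iff_right_iff_imp]
      rintro h rfl
      exact absurd h (hlt c hc).not_gt
    rw [Finset.coe_insert, Set.image_insert_eq, Finset.filter_insert,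
      Finset.filter_congr fun c hc => by rw [hs c hc], ha]
    split_ifs with h
    · rw [Submodule.span_insert_eq_span h, ih]
    · rw [finrank_span_insert_of_notMem (s.finite_toSet.image x) h, ih,
        Finset.card_insert_of_notMem fun h => has (Finset.mem_filter.1 h).1]

lemma ncard_standardIndices [AddCommGroup T] [Module k T] [LinearOrder Γ] (x : ι → T)
    (deg : ι → ℕ) {κ : ι → Γ} (hκ : Function.Injective κ) (t : ℕ) (hfin : {c | deg c = t}.Finite) :
    {c ∈ standardIndices k x deg κ | deg c = t}.ncard
      = Module.finrank k (Submodule.span k (x '' {c | deg c = t})) := by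
  classical
  have h := finrank_span_image_eq_card (k := k) x hκ hfin.toFinset
  rw [Set.Finite.coe_toFinset] at h
  rw [h, ← Set.ncard_coe_finset]
  congr 1
  ext c
  simp only [standardIndices, Set.mem_ofPred_eq, Finset.coe_filter, Set.Finite.mem_toFinset]
  constructor
  · rintro ⟨h1, rfl⟩
    exact ⟨rfl, h1⟩
  · rintro ⟨rfl, h1⟩
    exact ⟨h1, rfl⟩

/-- The product of the powers of the `v s` with exponents `c`. -/
def prodPow [CommMonoid T] {σ : Type*} [Fintype σ] (v : σ → T) (c : σ → ℕ) : T := ∏ s, v s ^ c s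

lemma prodPow_add [CommMonoid T] {σ : Type*} [Fintype σ] (v : σ → T) (c c' : σ → ℕ) :
    prodPow v (c + c') = prodPow v c * prodPow v c' := by
  simp [prodPow, pow_add, Finset.prod_mul_distrib]

lemma isLowerSet_standardIndices [CommRing T] [Algebra k T] {σ : Type*} [Fintype σ] (v : σ → T)
    [LinearOrder Γ] {κ : (σ → ℕ) → Γ} (deg : (σ → ℕ) → ℕ)
    (hdeg : ∀ c c', deg (c + c') = deg c + deg c')
    (hκ : ∀ c c' e, κ c < κ c' → κ (c + e) < κ (c' + e)) :
    IsLowerSet (standardIndices k (prodPow v) deg κ) := by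
  intro c' c hcc' hc' hc
  obtain ⟨e, rfl⟩ := exists_add_of_le hcc'
  refine hc' ?_
  rw [add_comm, prodPow_add]
  have h1 := Submodule.mem_map_of_mem (f := LinearMap.mulLeft k (prodPow v e)) hc
  rw [Submodule.map_span, ← Set.image_comp] at h1
  refine Submodule.span_mono ?_ h1
  rintro _ ⟨a, ⟨ha1, ha2⟩, rfl⟩
  refine ⟨a + e, ⟨?_, ?_⟩, ?_⟩
  · rw [add_comm e]
    exact hκ _ _ _ ha1
  · rw [hdeg, ha2, hdeg, add_comm]
  · simp [prodPow_add, mul_comm]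

end Standard

section ElimKey

variable {m n : ℕ}

/-- The key of the elimination order on the exponents of `K[y₁, …, yₘ, x₁, …, xₙ]`. -/
def elimKey (c : Fin m ⊕ Fin n → ℕ) : Lex (Lex (Fin m → ℕ) × Lex (Fin n → ℕ)) :=
  toLex (toLex fun i => c (.inl i), toLex fun j => c (.inr j))

lemma elimKey_injective : Function.Injective (elimKey (m := m) (n := n)) := by
  intro c c' h
  have h' := toLex_inj.1 h
  rw [Prod.mk.injEq, toLex_inj, toLex_inj] at h'
  funext s
  cases s with
  | inl i => exact congrFun h'.1 i
  | inr j => exact congrFun h'.2 j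

lemma elimKey_add_lt_add (c c' e : Fin m ⊕ Fin n → ℕ) (h : elimKey c < elimKey c') :
    elimKey (c + e) < elimKey (c' + e) := by
  rw [elimKey, elimKey, Prod.Lex.toLex_lt_toLex] at h ⊢
  rcases h with h | ⟨h1, h2⟩
  · exact Or.inl (add_lt_add_left h (toLex fun i => e (.inl i)))
  · refine Or.inr ⟨?_, add_lt_add_left h2 (toLex fun j => e (.inr j))⟩
    exact congrArg (· + toLex fun i => e (.inl i)) h1

/-- The degree in `K[y₁, …, yₘ]` of a product of variables `yᵢ` and forms of degree `d`. -/
def elimWeight (d : ℕ) (c : Fin m ⊕ Fin n → ℕ) : ℕ := ∑ i, c (.inl i) + d * ∑ j, c (.inr j)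

lemma elimWeight_add (d : ℕ) (c c' : Fin m ⊕ Fin n → ℕ) :
    elimWeight d (c + c') = elimWeight d c + elimWeight d c' := by
  simp only [elimWeight, Pi.add_apply, Finset.sum_add_distrib]
  ring

lemma finite_setOf_elimWeight_eq {d : ℕ} (hd : 0 < d) (t : ℕ) :
    {c : Fin m ⊕ Fin n → ℕ | elimWeight d c = t}.Finite := by
  refine (Set.finite_Iic fun _ => t).subset ?_
  rintro c rfl s
  have h1 : ∑ j, c (.inr j) ≤ d * ∑ j, c (.inr j) := Nat.le_mul_of_pos_left _ hd
  cases s with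
  | inl i =>
    have h2 := Finset.single_le_sum (f := fun i => c (.inl i)) (fun _ _ => Nat.zero_le _)
      (Finset.mem_univ i)
    exact h2.trans (Nat.le_add_right _ _)
  | inr j =>
    have h2 := Finset.single_le_sum (f := fun j => c (.inr j)) (fun _ _ => Nat.zero_le _)
      (Finset.mem_univ j)
    exact (h2.trans h1).trans (Nat.le_add_left _ _)

end ElimKey

section Standard

variable {k : Type*} [Field k] {m n d : ℕ}

lemma finrank_homogeneousSubmodule (t : ℕ) :
    Module.finrank k (homogeneousSubmodule (Fin m) k t) = {b : Fin m → ℕ | ∑ i, b i = t}.ncard := by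
  rw [homogeneousSubmodule_eq_finsupp_supported,
    (AddMonoidAlgebra.supportedEquivFinsupp {b : Fin m →₀ ℕ | b.degree = t}).finrank_eq]
  rw [← Set.ncard_image_of_injective _
    (Finsupp.equivFunOnFinite (α := Fin m) (M := ℕ)).symm.injective]
  have hset : Finsupp.equivFunOnFinite.symm '' {b : Fin m → ℕ | ∑ i, b i = t}
      = {b : Fin m →₀ ℕ | b.degree = t} := by
    rw [Equiv.image_symm_eq_preimage]
    ext b
    simp [Finsupp.degree_eq_sum]
  rw [hset]
  have hfin : {b : Fin m →₀ ℕ | b.degree = t}.Finite := by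
    rw [← hset]
    simpa using (Polynomial.finite_setOf_mem_sum_eq Set.univ t).image
      (Finsupp.equivFunOnFinite (α := Fin m) (M := ℕ)).symm
  have := hfin.fintype
  rw [Module.finrank_finsupp_self, Set.ncard_eq_toFinset_card', Set.toFinset_card]

variable {f : Fin n → MvPolynomial (Fin m) k}

lemma span_prodPow_eq_homogeneousSubmodule (hf : ∀ i, (f i).IsHomogeneous d) (t : ℕ) :
    Submodule.span k (prodPow (Sum.elim X f) '' {c | elimWeight d c = t})
      = homogeneousSubmodule (Fin m) k t := by
  refine le_antisymm (Submodule.span_le.2 ?_) fun p hp => ?_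
  · rintro _ ⟨c, rfl, rfl⟩
    rw [SetLike.mem_coe, mem_homogeneousSubmodule, elimWeight, prodPow, Fintype.prod_sum_type,
      Finset.mul_sum]
    refine .mul (.prod _ _ _ fun i _ => ?_) (.prod _ _ _ fun j _ => (hf j).pow _)
    simpa using (isHomogeneous_X k i).pow (c (.inl i))
  · rw [p.as_sum]
    refine Submodule.sum_mem _ fun b hb => ?_
    rw [← mul_one (p.coeff b), ← smul_eq_mul, ← smul_monomial]
    refine Submodule.smul_mem _ _ (Submodule.subset_span ⟨Sum.elim b 0, ?_, ?_⟩)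
    · have := (mem_homogeneousSubmodule _ _).1 hp (mem_support_iff.1 hb)
      simpa [elimWeight, Finsupp.weight_apply, Finsupp.sum_fintype] using this
    · simp [prodPow, monomial_eq, Finsupp.prod_fintype]

/-- The exponents that lie in `N` after rounding the exponents of the second kind of variables
down to multiples of `d` and dividing by `d`. -/
def roundedSet (d : ℕ) (N : Set (Fin m ⊕ Fin n → ℕ)) : Set (Fin m ⊕ Fin n → ℕ) :=
  {c | Sum.elim (fun i => c (.inl i)) (fun j => c (.inr j) / d) ∈ N}

lemma _root_.IsLowerSet.roundedSet {N : Set (Fin m ⊕ Fin n → ℕ)} (hN : IsLowerSet N) (d : ℕ) :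
    IsLowerSet (roundedSet d N) := by
  intro c c' h hc
  refine hN (fun s => ?_) hc
  cases s with
  | inl i => exact h (.inl i)
  | inr j => exact Nat.div_le_div_right (h (.inr j))

namespace Polynomial

lemma one_sub_X_pow_mul_hilbertSeries_univ :
    (1 - PowerSeries.X) ^ m * hilbertSeries (Set.univ : Set (Fin m → ℕ)) = 1 := by
  have huniv : cone (0 : Fin m → ℕ) Finset.univ = Set.univ :=
    Set.eq_univ_of_forall fun c =>
      ⟨fun s => Nat.zero_le _, fun s hs => absurd (Finset.mem_univ s) hs⟩
  simpa [huniv] using one_sub_X_pow_mul_hilbertSeries_cone (0 : Fin m → ℕ) Finset.univ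

lemma hilbertSeries_roundedSet (hd : 0 < d) {N : Set (Fin m ⊕ Fin n → ℕ)}
    (hN : ∀ t, {c ∈ N | elimWeight d c = t}.ncard = {b : Fin m → ℕ | ∑ i, b i = t}.ncard) :
    hilbertSeries (roundedSet d N)
      = (((∑ i ∈ Finset.range d, X ^ i) ^ n : ℤ[X]) : PowerSeries ℤ) *
        hilbertSeries (Set.univ : Set (Fin m → ℕ)) := by
  classical
  have hg : ((∑ i ∈ Finset.range d, X ^ i) ^ n : ℤ[X])
      = ∑ e ∈ Fintype.piFinset fun _ : Fin n => Finset.range d, X ^ ∑ j, e j := by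
    rw [← Fin.prod_const, Finset.prod_univ_sum]
    exact Finset.sum_congr rfl fun e _ => Finset.prod_pow_eq_pow_sum _ _ _
  ext t
  have hcoe : (((∑ e ∈ Fintype.piFinset fun _ : Fin n => Finset.range d, X ^ ∑ j, e j : ℤ[X])) :
      PowerSeries ℤ) = ∑ e ∈ Fintype.piFinset fun _ : Fin n => Finset.range d,
        PowerSeries.X ^ ∑ j, e j := by
    rw [← coeToPowerSeries.ringHom_apply, map_sum]
    simp
  rw [hg, hcoe, Finset.sum_mul, map_sum, hilbertSeries, PowerSeries.coeff_mk,
    Set.ncard_eq_toFinset_card _ (finite_setOf_mem_sum_eq _ t),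
    Finset.card_eq_sum_card_fiberwise (f := fun c j => c (.inr j) % d)
      (t := Fintype.piFinset fun _ : Fin n => Finset.range d) fun c _ => by
        simpa using fun _ => Nat.mod_lt _ hd]
  push_cast
  refine Finset.sum_congr rfl fun e he => ?_
  simp only [Fintype.mem_piFinset, Finset.mem_range] at he
  rw [PowerSeries.coeff_X_pow_mul']
  have hsum : ∀ c : Fin m ⊕ Fin n → ℕ, (∀ j, c (.inr j) % d = e j) → ∑ s, c s
      = elimWeight d (Sum.elim (fun i => c (.inl i)) fun j => c (.inr j) / d) + ∑ j, e j := by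
    intro c hc
    rw [Fintype.sum_sum_type, elimWeight, add_assoc, Finset.mul_sum, ← Finset.sum_add_distrib]
    simp only [Sum.elim_inl, Sum.elim_inr]
    exact congrArg _ (Finset.sum_congr rfl fun j _ => by rw [← hc j, Nat.div_add_mod])
  split_ifs with hle
  · rw [hilbertSeries, PowerSeries.coeff_mk, Nat.cast_inj]
    simp only [Set.mem_univ, true_and]
    rw [← hN, ← Set.ncard_coe_finset]
    refine Set.ncard_congr (fun c _ => Sum.elim (fun i => c (.inl i)) fun j => c (.inr j) / d)
      ?_ ?_ ?_
    · intro c hc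
      simp only [Finset.coe_filter, Set.Finite.mem_toFinset, Set.mem_ofPred_eq] at hc
      have := hsum c (congrFun hc.2)
      exact ⟨hc.1.1, by omega⟩
    · intro c c' hc hc' h
      simp only [Finset.coe_filter, Set.Finite.mem_toFinset, Set.mem_ofPred_eq] at hc hc'
      funext s
      cases s with
      | inl i => exact congrFun h (.inl i)
      | inr j =>
        rw [← Nat.div_add_mod (c (.inr j)) d, ← Nat.div_add_mod (c' (.inr j)) d, congrFun hc.2 j,
          congrFun hc'.2 j, show c (.inr j) / d = c' (.inr j) / d from congrFun h (.inr j)]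
    · rintro c ⟨hc, hct⟩
      have hdiv : (Sum.elim (fun i => c (.inl i)) fun j => (d * c (.inr j) + e j) / d) = c := by
        funext s
        cases s with
        | inl i => rfl
        | inr j =>
          rw [Sum.elim_inr, Nat.mul_add_div hd, Nat.div_eq_of_lt (he j), add_zero]
      have hmod : ∀ j, (d * c (.inr j) + e j) % d = e j := fun j => by
        rw [Nat.mul_add_mod, Nat.mod_eq_of_lt (he j)]
      refine ⟨Sum.elim (fun i => c (.inl i)) fun j => d * c (.inr j) + e j, ?_, hdiv⟩
      simp only [Finset.coe_filter, Set.Finite.mem_toFinset, Set.mem_ofPred_eq]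
      refine ⟨⟨?_, ?_⟩, _root_.funext hmod⟩
      · exact (congrArg (· ∈ N) hdiv).mpr hc
      · rw [hsum _ hmod]
        simp only [Sum.elim_inl, Sum.elim_inr]
        rw [hdiv]
        omega
  · rw [Nat.cast_eq_zero, Finset.card_eq_zero, Finset.filter_eq_empty_iff]
    intro c hc h
    have := hsum c (congrFun h)
    have := ((finite_setOf_mem_sum_eq _ t).mem_toFinset.1 hc).2
    omega

end Polynomial

lemma exists_coneFiltration_roundedSet (hd : 0 < d) (hf : ∀ i, (f i).IsHomogeneous d) :
    ∃ Q, ConeFiltration (roundedSet d (standardIndices k (prodPow (Sum.elim X f)) (elimWeight d)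
      elimKey)) Q ∧ ∀ q ∈ Q, q.1 < (d ^ n) ^ 2 ^ (m - 1) := by
  have hlow : IsLowerSet (standardIndices k (prodPow (Sum.elim X f)) (elimWeight d) elimKey) :=
    isLowerSet_standardIndices _ _ (elimWeight_add d) elimKey_add_lt_add
  have hN : ∀ t, {c ∈ standardIndices k (prodPow (Sum.elim X f)) (elimWeight d) elimKey |
      elimWeight d c = t}.ncard = {b : Fin m → ℕ | ∑ i, b i = t}.ncard := fun t => by
    rw [ncard_standardIndices _ _ elimKey_injective _ (finite_setOf_elimWeight_eq hd t),
      span_prodPow_eq_homogeneousSubmodule hf, finrank_homogeneousSubmodule]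
  generalize standardIndices k (prodPow (Sum.elim X f)) (elimWeight d) elimKey = N at hlow hN
  obtain ⟨Q, hQ, hst⟩ := (hlow.roundedSet d).exists_standard_coneFiltration
  have hV : Fintype.card (Fin m ⊕ Fin n) = m + n := by simp
  refine hQ.exists_forall_lt_pow_of_isStandard hd hst hV (Polynomial.coe_injective _ ?_)
  rw [← hV, ← hQ.one_sub_X_pow_mul_hilbertSeries, Polynomial.hilbertSeries_roundedSet hd hN, hV,
    pow_add, Polynomial.coe_mul, Polynomial.coe_pow (φ := 1 - Polynomial.X), Polynomial.coe_sub,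
    Polynomial.coe_one, Polynomial.coe_X]
  linear_combination (1 - PowerSeries.X) ^ n *
    (((∑ i ∈ Finset.range d, Polynomial.X ^ i) ^ n : Polynomial ℤ) : PowerSeries ℤ) *
      Polynomial.one_sub_X_pow_mul_hilbertSeries_univ (m := m)

end Standard

section Lift

variable {k T : Type*} [Field k] [CommRing T] [Algebra k T] {n : ℕ}

/-- The exponent of the squarefree monomial with support `F`. -/
def indicatorExponent (F : Finset (Fin n)) (s : Fin n) : ℕ := if s ∈ F then 1 else 0

lemma indicatorExponent_insert {F : Finset (Fin n)} {t : Fin n} (ht : t ∉ F) :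
    indicatorExponent (insert t F) = indicatorExponent F + Pi.single t 1 := by
  funext s
  by_cases hs : s = t
  · subst hs
    simp [indicatorExponent, ht]
  · simp [indicatorExponent, hs]

lemma sum_indicatorExponent (F : Finset (Fin n)) : ∑ s, indicatorExponent F s = F.card := by
  simp [indicatorExponent]

/-- The sets `F` for which the monomial of exponent `a` is the product of the squarefree monomial
with support `F` and a monomial with exponent in `M`. -/
def strandFamily (M : Set (Fin n → ℕ)) (a : Fin n → ℕ) : Set (Finset (Fin n)) :=
  {F | ∃ p ∈ M, p + indicatorExponent F = a}

/-- The coefficients of the squarefree monomial with support `F` in the chains of multidegree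
in `A`. -/
def strandSpan (k : Type*) {T : Type*} [Field k] [CommRing T] [Algebra k T] {n : ℕ}
    (v : Fin n → T) (A : Set (Fin n → ℕ)) (F : Finset (Fin n)) : Submodule k T :=
  Submodule.span k (prodPow v '' {c | c + indicatorExponent F ∈ A})

variable (v : Fin n → T)

variable {v} in
lemma prodPow_mem_strandSpan {A : Set (Fin n → ℕ)} {F : Finset (Fin n)} {c : Fin n → ℕ}
    (h : c + indicatorExponent F ∈ A) : prodPow v c ∈ strandSpan k v A F :=
  Submodule.subset_span ⟨c, h, rfl⟩

lemma strandSpan_mono {A B : Set (Fin n → ℕ)} (h : A ⊆ B) (F : Finset (Fin n)) :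
    strandSpan k v A F ≤ strandSpan k v B F :=
  Submodule.span_mono (Set.image_mono fun _ hc => h hc)

lemma prodPow_single (t : Fin n) : prodPow v (Pi.single t 1) = v t := by
  rw [prodPow, Finset.prod_eq_single t]
  · simp
  · intro s _ hs
    simp [hs]
  · simp

lemma mul_mem_strandSpan {A : Set (Fin n → ℕ)} {F : Finset (Fin n)} {t : Fin n} (ht : t ∉ F)
    {x : T} (hx : x ∈ strandSpan k v A (insert t F)) : v t * x ∈ strandSpan k v A F := by
  have h := Submodule.mem_map_of_mem (f := LinearMap.mulLeft k (v t)) hx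
  rw [strandSpan, Submodule.map_span, ← Set.image_comp] at h
  refine Submodule.span_mono ?_ h
  rintro _ ⟨c, hc, rfl⟩
  refine ⟨c + Pi.single t 1, ?_, ?_⟩
  · rw [Set.mem_ofPred_eq, indicatorExponent_insert ht] at hc
    rwa [Set.mem_ofPred_eq, add_assoc, add_comm (Pi.single t 1)]
  · simp [prodPow_add, prodPow_single, mul_comm]

lemma koszulD_mem_strandSpan {A : Set (Fin n → ℕ)} {w : Finset (Fin n) → T}
    (hw : ∀ F, w F ∈ strandSpan k v A F) (F : Finset (Fin n)) :
    koszulD v w F ∈ strandSpan k v A F := by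
  unfold koszulD
  refine Submodule.sum_mem _ fun t _ => ?_
  split_ifs with ht
  · exact zero_mem _
  · have h := mul_mem_strandSpan v ht (hw (insert t F))
    rcases neg_one_pow_eq_or T (F.filter (· < t)).card with h1 | h1 <;> rw [h1]
    · rwa [one_mul]
    · rw [neg_one_mul]
      exact neg_mem h

lemma koszulD_smul_prodPow (a : Fin n → ℕ) {μ : Finset (Fin n) → k}
    (hμ : ∀ F, μ F ≠ 0 → indicatorExponent F ≤ a) (G : Finset (Fin n)) :
    koszulD v (fun F => μ F • prodPow v (a - indicatorExponent F)) G
      = koszulD (fun _ => 1) μ G • prodPow v (a - indicatorExponent G) := by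
  unfold koszulD
  rw [Finset.sum_smul]
  refine Finset.sum_congr rfl fun t _ => ?_
  split_ifs with ht
  · rw [zero_smul]
  · by_cases h0 : μ (insert t G) = 0
    · simp [h0]
    · have hle := hμ _ h0
      have h1 : prodPow v (a - indicatorExponent G)
          = v t * prodPow v (a - indicatorExponent (insert t G)) := by
        rw [← prodPow_single v, ← prodPow_add]
        congr 1
        rw [indicatorExponent_insert ht] at hle ⊢
        funext s
        have h2 : indicatorExponent G s + (Pi.single t 1 : Fin n → ℕ) s ≤ a s := hle s
        change a s - indicatorExponent G s = (Pi.single t 1 : Fin n → ℕ) s +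
          (a s - (indicatorExponent G s + (Pi.single t 1 : Fin n → ℕ) s))
        omega
      rw [h1]
      simp only [Algebra.smul_def, map_mul, map_pow, map_neg, map_one, one_mul]
      ring

lemma prodPow_sub_mem_strandSpan {A : Set (Fin n → ℕ)} {a : Fin n → ℕ} {F : Finset (Fin n)}
    (hF : indicatorExponent F ≤ a)
    (hA : ∀ b : Fin n → ℕ, toLex b < toLex a → ∑ s, b s = ∑ s, a s → b ∈ A)
    (hns : F ∉ strandFamily (standardIndices k (prodPow v) (fun c => ∑ s, c s) toLex) a) :
    prodPow v (a - indicatorExponent F) ∈ strandSpan k v A F := by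
  have h : a - indicatorExponent F ∉ standardIndices k (prodPow v) (fun c => ∑ s, c s) toLex :=
    fun h => hns ⟨_, h, tsub_add_cancel_of_le hF⟩
  rw [standardIndices, Set.mem_ofPred_eq, not_not] at h
  refine Submodule.span_mono (Set.image_mono ?_) h
  rintro c ⟨h1, h2⟩
  refine hA _ ?_ ?_
  · have h3 : toLex c + toLex (indicatorExponent F)
        < toLex (a - indicatorExponent F) + toLex (indicatorExponent F) := add_lt_add_left h1 _
    rw [← toLex_add, ← toLex_add, tsub_add_cancel_of_le hF] at h3
    exact h3
  · rw [← tsub_add_cancel_of_le hF]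
    simp only [Pi.add_apply, Finset.sum_add_distrib] at h2 ⊢
    rw [h2]

lemma coeff_eq_zero_of_smul_mem_strandSpan {A : Set (Fin n → ℕ)} {a : Fin n → ℕ}
    {F : Finset (Fin n)} {r : k}
    (hA : ∀ b ∈ A, toLex b < toLex a ∧ ∑ s, b s = ∑ s, a s)
    (hF : F ∈ strandFamily (standardIndices k (prodPow v) (fun c => ∑ s, c s) toLex) a)
    (hr : r • prodPow v (a - indicatorExponent F) ∈ strandSpan k v A F) : r = 0 := by
  by_contra h0
  obtain ⟨p, hp, rfl⟩ := hF
  rw [Submodule.smul_mem_iff _ h0, add_tsub_cancel_right] at hr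
  refine hp (Submodule.span_mono (Set.image_mono ?_) hr)
  intro c hc
  obtain ⟨h1, h2⟩ := hA _ hc
  refine ⟨?_, ?_⟩
  · rw [toLex_add, toLex_add] at h1
    exact lt_of_add_lt_add_right h1
  · simpa [Finset.sum_add_distrib] using h2

lemma exists_smul_prodPow_add {A : Set (Fin n → ℕ)} {a : Fin n → ℕ}
    (hA : ∀ b : Fin n → ℕ, toLex b < toLex a → ∑ s, b s = ∑ s, a s → b ∈ A)
    {F : Finset (Fin n)} {x : T} (hx : x ∈ strandSpan k v (insert a A) F) :
    ∃ r : k, (r ≠ 0 →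
        F ∈ strandFamily (standardIndices k (prodPow v) (fun c => ∑ s, c s) toLex) a ∧ x ≠ 0) ∧
      x - r • prodPow v (a - indicatorExponent F) ∈ strandSpan k v A F := by
  by_cases hF : F ∈ strandFamily (standardIndices k (prodPow v) (fun c => ∑ s, c s) toLex) a
  · by_cases hx0 : x = 0
    · exact ⟨0, fun h => absurd rfl h, by simp [hx0]⟩
    have hle : strandSpan k v (insert a A) F
        ≤ Submodule.span k {prodPow v (a - indicatorExponent F)} ⊔ strandSpan k v A F := by
      refine Submodule.span_le.2 ?_
      rintro _ ⟨c, rfl | hc, rfl⟩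
      · rw [add_tsub_cancel_right]
        exact Submodule.mem_sup_left (Submodule.mem_span_singleton_self _)
      · exact Submodule.mem_sup_right (prodPow_mem_strandSpan hc)
    obtain ⟨y, hy, z, hz, rfl⟩ := Submodule.mem_sup.1 (hle hx)
    obtain ⟨r, rfl⟩ := Submodule.mem_span_singleton.1 hy
    exact ⟨r, fun _ => ⟨hF, hx0⟩, by rwa [add_sub_cancel_left]⟩
  · refine ⟨0, fun h => absurd rfl h, ?_⟩
    rw [zero_smul, sub_zero]
    refine Submodule.span_le.2 ?_ hx
    rintro _ ⟨c, hc | hc, rfl⟩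
    · have h := prodPow_sub_mem_strandSpan (k := k) v (F := F) (hc ▸ fun s => Nat.le_add_left _ _)
        hA hF
      rwa [← hc, add_tsub_cancel_right] at h
    · exact prodPow_mem_strandSpan hc

lemma indicatorExponent_le_of_mem_strandFamily {M : Set (Fin n → ℕ)} {a : Fin n → ℕ}
    {F : Finset (Fin n)} (hF : F ∈ strandFamily M a) : indicatorExponent F ≤ a := by
  obtain ⟨p, -, rfl⟩ := hF
  exact fun s => Nat.le_add_left _ _

lemma exists_koszulD_eq_of_finset {i j : ℕ}
    (hex : ∀ a : Fin n → ℕ, ∑ s, a s = j → FamilyExact k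
      (strandFamily (standardIndices k (prodPow v) (fun c => ∑ s, c s) toLex) a) i)
    (A : Finset (Fin n → ℕ)) (hA : ∀ a ∈ A, ∑ s, a s = j)
    (hlow : ∀ a ∈ A, ∀ b : Fin n → ℕ, toLex b < toLex a → ∑ s, b s = j → b ∈ A)
    (z : Finset (Fin n) → T) (hz : ∀ F, z F ∈ strandSpan k v A F)
    (hsupp : ∀ F, z F ≠ 0 → F.card = i) (hcyc : ∀ G, koszulD v z G = 0) :
    ∃ w : Finset (Fin n) → T, (∀ F, w F ∈ strandSpan k v A F) ∧
      (∀ F, w F ≠ 0 → F.card = i + 1) ∧ ∀ G, koszulD v w G = z G := by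
  classical
  induction A using Finset.induction_on_max_value
    (toLex : (Fin n → ℕ) → Lex (Fin n → ℕ)) generalizing z with
  | empty =>
    have h0 : ∀ F, z F = 0 := fun F => by simpa [strandSpan] using hz F
    exact ⟨fun _ => 0, fun F => zero_mem _, fun F h => absurd rfl h, fun G => by
      rw [h0, koszulD_eq_zero fun _ _ => rfl]⟩
  | insert a A ha hmax ih =>
    have hlt : ∀ b ∈ A, toLex b < toLex a ∧ ∑ s, b s = ∑ s, a s := fun b hb =>
      ⟨(hmax b hb).lt_of_ne fun h => ha (toLex_inj.1 h ▸ hb), by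
        rw [hA b (Finset.mem_insert_of_mem hb), hA a (Finset.mem_insert_self _ _)]⟩
    have hbelow : ∀ b : Fin n → ℕ, toLex b < toLex a → ∑ s, b s = ∑ s, a s →
        b ∈ (A : Set (Fin n → ℕ)) := fun b h1 h2 =>
      Finset.mem_of_mem_insert_of_ne
        (hlow a (Finset.mem_insert_self _ _) b h1 (h2.trans (hA a (Finset.mem_insert_self _ _))))
        fun h => h1.ne (congrArg toLex h)
    have hlow' : ∀ a' ∈ A, ∀ b : Fin n → ℕ, toLex b < toLex a' → ∑ s, b s = j → b ∈ A :=
      fun a' ha' b h1 h2 => hbelow b (h1.trans (hlt a' ha').1)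
        (h2.trans (hA a (Finset.mem_insert_self _ _)).symm)
    rw [Finset.coe_insert] at hz ⊢
    choose r hr hzr using fun F => exists_smul_prodPow_add v hbelow (hz F)
    have hle : ∀ F, r F ≠ 0 → indicatorExponent F ≤ a := fun F h =>
      indicatorExponent_le_of_mem_strandFamily (hr F h).1
    obtain ⟨μ, hμ, hμr⟩ := hex a (hA a (Finset.mem_insert_self _ _)) r
      (fun F h => ⟨(hr F h).1, hsupp F (hr F h).2⟩) fun G hG => by
        refine coeff_eq_zero_of_smul_mem_strandSpan v hlt hG ?_
        have h := koszulD_mem_strandSpan v hzr G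
        rw [koszulD_sub, hcyc, koszulD_smul_prodPow v a hle, zero_sub] at h
        exact neg_mem_iff.1 h
    have hμle : ∀ F, μ F ≠ 0 → indicatorExponent F ≤ a := fun F h =>
      indicatorExponent_le_of_mem_strandFamily (hμ F h).1
    have hD := koszulD_smul_prodPow v a hμle
    obtain ⟨w, hw, hwsupp, hwz⟩ := ih (fun b hb => hA b (Finset.mem_insert_of_mem hb)) hlow'
      (fun F => z F - koszulD v (fun F => μ F • prodPow v (a - indicatorExponent F)) F)
      (fun F => by
        rw [hD]
        by_cases hF : F ∈ strandFamily (standardIndices k (prodPow v) (fun c => ∑ s, c s) toLex) a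
        · rw [hμr F hF]
          exact hzr F
        · have hr0 : r F = 0 := by
            by_contra h
            exact hF (hr F h).1
          have hzF := hzr F
          rw [hr0, zero_smul, sub_zero] at hzF
          refine sub_mem hzF ?_
          by_cases hc : koszulD (fun _ => 1) μ F = 0
          · rw [hc, zero_smul]
            exact zero_mem _
          · obtain ⟨t, ht, hne⟩ := exists_of_koszulD_ne_zero hc
            have h1 := hμle _ hne
            rw [indicatorExponent_insert ht] at h1
            exact Submodule.smul_mem _ _ (prodPow_sub_mem_strandSpan v
              (fun s => (Nat.le_add_right _ _).trans (h1 s)) hbelow hF))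
      (fun F hF => by
        by_cases hzF : z F = 0
        · rw [hzF, zero_sub, neg_ne_zero] at hF
          obtain ⟨t, ht, hne⟩ := exists_of_koszulD_ne_zero hF
          have h1 := (hμ _ (left_ne_zero_of_smul hne)).2
          rw [Finset.card_insert_of_notMem ht] at h1
          omega
        · exact hsupp F hzF)
      (fun G => by rw [koszulD_sub, hcyc, koszulD_koszulD, sub_zero])
    refine ⟨fun F => w F + μ F • prodPow v (a - indicatorExponent F), fun F => ?_, fun F hF => ?_,
      fun G => ?_⟩
    · refine add_mem (strandSpan_mono v (Set.subset_insert _ _) F (hw F)) ?_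
      by_cases h : μ F = 0
      · rw [h, zero_smul]
        exact zero_mem _
      · refine Submodule.smul_mem _ _ (prodPow_mem_strandSpan ?_)
        rw [tsub_add_cancel_of_le (hμle F h)]
        exact Set.mem_insert _ _
    · by_cases h : w F = 0
      · beta_reduce at hF
        rw [h, zero_add] at hF
        exact (hμ F (left_ne_zero_of_smul hF)).2
      · exact hwsupp F h
    · rw [koszulD_add, hwz, sub_add_cancel]

/-- If all strands of the initial algebra are exact, then the Koszul homology of the algebra
generated by the `v s` vanishes. -/
lemma exists_koszulD_eq {i j : ℕ}
    (hex : ∀ a : Fin n → ℕ, ∑ s, a s = j → FamilyExact k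
      (strandFamily (standardIndices k (prodPow v) (fun c => ∑ s, c s) toLex) a) i)
    (z : Finset (Fin n) → T) (hz : ∀ F, z F ∈ strandSpan k v {a | ∑ s, a s = j} F)
    (hsupp : ∀ F, z F ≠ 0 → F.card = i) (hcyc : ∀ G, koszulD v z G = 0) :
    ∃ w : Finset (Fin n) → T, (∀ F, w F ∈ strandSpan k v {a | ∑ s, a s = j} F) ∧
      (∀ F, w F ≠ 0 → F.card = i + 1) ∧ ∀ G, koszulD v w G = z G := by
  have hfin : {a : Fin n → ℕ | ∑ s, a s = j}.Finite := by
    simpa using Polynomial.finite_setOf_mem_sum_eq (σ := Fin n) Set.univ j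
  have h := exists_koszulD_eq_of_finset v hex hfin.toFinset (by simp) (by simp +contextual) z
  rw [hfin.coe_toFinset] at h
  exact h hz hsupp hcyc

end Lift

section Elimination

variable {k : Type*} [Field k] {m n d : ℕ} {f : Fin n → MvPolynomial (Fin m) k}

lemma elim_zero_mem_standardIndices_iff (hd : 0 < d) (a : Fin n → ℕ) :
    Sum.elim (0 : Fin m → ℕ) a ∈ standardIndices k (prodPow (Sum.elim X f)) (elimWeight d) elimKey ↔
      a ∈ standardIndices k (prodPow f) (fun c => ∑ s, c s) toLex := by
  have hprod : ∀ c : Fin n → ℕ,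
      prodPow (Sum.elim (X : Fin m → MvPolynomial (Fin m) k) f)
        (Sum.elim (0 : Fin m → ℕ) c) = prodPow f c :=
    fun c => by simp [prodPow]
  rw [standardIndices, standardIndices, Set.mem_ofPred_eq, Set.mem_ofPred_eq, hprod]
  have himage : prodPow (Sum.elim (X : Fin m → MvPolynomial (Fin m) k) f) ''
      {c | elimKey c < elimKey (Sum.elim 0 a) ∧
        elimWeight d c = elimWeight d (Sum.elim (0 : Fin m → ℕ) a)}
      = prodPow f '' {c | toLex c < toLex a ∧ ∑ s, c s = ∑ s, a s} := by
    ext p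
    constructor
    · rintro ⟨c, ⟨h1, h2⟩, rfl⟩
      rw [elimKey, elimKey, Prod.Lex.toLex_lt_toLex] at h1
      have hz : ¬ toLex (fun i => c (.inl i)) < toLex (0 : Fin m → ℕ) :=
        not_lt.2 (Pi.toLex_monotone fun i => Nat.zero_le _)
      obtain ⟨h3, h4⟩ := h1.resolve_left hz
      have hc : c = Sum.elim (0 : Fin m → ℕ) fun j => c (.inr j) := by
        funext s
        cases s with
        | inl i => exact congrFun (toLex_inj.1 h3) i
        | inr j => rfl
      rw [hc] at h2
      refine ⟨fun j => c (.inr j), ⟨h4, ?_⟩, ?_⟩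
      · simpa [elimWeight, hd.ne'] using h2
      · rw [← hprod, ← hc]
    · rintro ⟨c, ⟨h1, h2⟩, rfl⟩
      refine ⟨Sum.elim 0 c, ⟨?_, ?_⟩, hprod c⟩
      · rw [elimKey, elimKey, Prod.Lex.toLex_lt_toLex]
        exact Or.inr ⟨rfl, h1⟩
      · simp [elimWeight, h2]
  exact (congrArg (fun s => prodPow f a ∉ Submodule.span k s) himage).to_iff

lemma strandFamily_standardIndices (hd : 0 < d) (a : Fin n → ℕ) :
    {F : Finset (Fin n) | ∃ p ∈ roundedSet d
        (standardIndices k (prodPow (Sum.elim X f)) (elimWeight d) elimKey),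
      ∀ s, p s + (if s ∈ F.map Function.Embedding.inr then 1 else 0)
        = Sum.elim (0 : Fin m → ℕ) (fun j => d * a j) s}
      = strandFamily (standardIndices k (prodPow f) (fun c => ∑ s, c s) toLex) a := by
  ext F
  constructor
  · rintro ⟨p, hp, h⟩
    have hp0 : ∀ i, p (.inl i) = 0 := fun i => by simpa using h (.inl i)
    have hp1 : ∀ j, p (.inr j) + indicatorExponent F j = d * a j := fun j => by
      simpa [indicatorExponent] using h (.inr j)
    refine ⟨fun j => p (.inr j) / d, ?_, funext fun j => ?_⟩
    · rw [← elim_zero_mem_standardIndices_iff hd]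
      refine (congrArg (· ∈ standardIndices k (prodPow (Sum.elim X f)) (elimWeight d)
        elimKey) ?_).mpr hp
      funext s
      cases s with
      | inl i => exact (hp0 i).symm
      | inr j => rfl
    · change p (.inr j) / d + indicatorExponent F j = a j
      have h1 := hp1 j
      unfold indicatorExponent at h1 ⊢
      split_ifs at h1 ⊢ with hj
      · obtain ⟨b, hb⟩ : ∃ b, a j = b + 1 := Nat.exists_eq_add_one.2 (by
          rcases Nat.eq_zero_or_pos (a j) with h0 | h0
          · simp [h0] at h1
          · exact h0)
        rw [hb, mul_add] at h1
        rw [hb, show p (.inr j) = d * b + (d - 1) by omega, Nat.mul_add_div hd,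
          Nat.div_eq_of_lt (by omega), add_zero]
      · rw [add_zero] at h1 ⊢
        rw [h1, Nat.mul_div_cancel_left _ hd]
  · rintro ⟨p, hp, rfl⟩
    refine ⟨Sum.elim 0 fun j => d * p j + (d - 1) * indicatorExponent F j, ?_, fun s => ?_⟩
    · rw [← elim_zero_mem_standardIndices_iff hd] at hp
      refine (congrArg (· ∈ standardIndices k (prodPow (Sum.elim X f)) (elimWeight d)
        elimKey) ?_).mpr hp
      funext s
      cases s with
      | inl i => rfl
      | inr j =>
        have h1 : (d - 1) * indicatorExponent F j < d := by
          unfold indicatorExponent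
          split_ifs <;> omega
        simp only [Sum.elim_inr]
        rw [Nat.mul_add_div hd, Nat.div_eq_of_lt h1, add_zero]
    · cases s with
      | inl i => simp
      | inr j =>
        simp only [Sum.elim_inr, Finset.mem_map, Function.Embedding.inr_apply, Sum.inr.injEq,
          exists_eq_right, Pi.add_apply, indicatorExponent]
        obtain ⟨e, rfl⟩ := Nat.exists_eq_add_one.2 hd
        split_ifs
        · simp
          ring
        · simp

lemma familyExact_strandFamily (hd : 0 < d) (hf : ∀ i, (f i).IsHomogeneous d) {a : Fin n → ℕ}
    {i : ℕ} (ha : (d ^ n) ^ 2 ^ (m - 1) + i ≤ d * ∑ s, a s) : FamilyExact k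
      (strandFamily (standardIndices k (prodPow f) (fun c => ∑ s, c s) toLex) a) i := by
  obtain ⟨Q, hQ, hlt⟩ := exists_coneFiltration_roundedSet hd hf
  rw [← strandFamily_standardIndices hd]
  refine hQ.familyExact Function.Embedding.inr _ ?_ i fun q hq => ?_
  · rintro (s | s) hs
    · rfl
    · exact absurd ⟨s, rfl⟩ hs
  · have := hlt q hq
    rw [Fintype.sum_sum_type]
    simp only [Sum.elim_inl, Sum.elim_inr, Pi.zero_apply, Finset.sum_const_zero, zero_add,
      ← Finset.mul_sum]
    omega

lemma familyExact_strandFamily_X {a : Fin n → ℕ} (ha : ∑ s, a s ≠ 0) (i : ℕ) : FamilyExact k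
    (strandFamily (standardIndices k (prodPow (X : Fin n → MvPolynomial (Fin n) k))
      (fun c => ∑ s, c s) toLex) a) i := by
  have hall : ∀ c, c ∈ standardIndices k (prodPow (X : Fin n → MvPolynomial (Fin n) k))
      (fun c => ∑ s, c s) toLex := by
    intro c hc
    have hprod : prodPow (X : Fin n → MvPolynomial (Fin n) k)
        = basisMonomials (Fin n) k ∘ Finsupp.equivFunOnFinite.symm := by
      funext c
      simp [prodPow, monomial_eq, Finsupp.prod_fintype]
    have hind : LinearIndependent k (prodPow (X : Fin n → MvPolynomial (Fin n) k)) := by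
      rw [hprod]
      exact (basisMonomials (Fin n) k).linearIndependent.comp _ (Equiv.injective _)
    refine hind.notMem_span_image (s := {c' | toLex c' < toLex c ∧ ∑ s, c' s = ∑ s, c s}) ?_ hc
    exact fun h => lt_irrefl _ h.1
  obtain ⟨x, -, hx⟩ := Finset.exists_ne_zero_of_sum_ne_zero ha
  refine .of_pairing i x fun G hG => ⟨?_, ?_⟩
  · rintro ⟨p, -, rfl⟩
    refine ⟨p + Pi.single x 1, hall _, ?_⟩
    rw [indicatorExponent_insert hG, add_assoc, add_comm (Pi.single x 1)]
  · rintro ⟨p, -, rfl⟩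
    refine ⟨p - Pi.single x 1, hall _, ?_⟩
    rw [indicatorExponent_insert hG, add_comm (indicatorExponent G), ← add_assoc,
      tsub_add_cancel_of_le]
    intro s
    by_cases hs : s = x
    · subst hs
      have h1 : p s + indicatorExponent G s ≠ 0 := hx
      rw [indicatorExponent, if_neg hG, add_zero] at h1
      simpa using Nat.one_le_iff_ne_zero.2 h1
    · simp [hs]

end Elimination

section Kernel

variable {k : Type*} [Field k] {m n d : ℕ} {f : Fin n → MvPolynomial (Fin m) k}

lemma strandSpan_X {j e : ℕ} {F : Finset (Fin n)} (h : e + F.card = j) :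
    strandSpan k (X : Fin n → MvPolynomial (Fin n) k) {a | ∑ s, a s = j} F
      = homogeneousSubmodule (Fin n) k e := by
  have h0 := span_prodPow_eq_homogeneousSubmodule (k := k) (m := n) (d := 0)
    (f := (Fin.elim0 : Fin 0 → MvPolynomial (Fin n) k)) (fun i => i.elim0) e
  rw [← h0, strandSpan]
  congr 1
  ext p
  constructor
  · rintro ⟨c, hc, rfl⟩
    refine ⟨Sum.elim c Fin.elim0, ?_, by simp [prodPow]⟩
    have h1 : ∑ s, (c s + indicatorExponent F s) = j := hc
    rw [Finset.sum_add_distrib, sum_indicatorExponent] at h1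
    simp only [elimWeight, Set.mem_ofPred_eq, Sum.elim_inl]
    omega
  · rintro ⟨c, hc, rfl⟩
    refine ⟨fun i => c (.inl i), ?_, by simp [prodPow]⟩
    have h1 : ∑ i, c (.inl i) + 0 * ∑ j, c (.inr j) = e := hc
    change ∑ s, (c (.inl s) + indicatorExponent F s) = j
    rw [Finset.sum_add_distrib, sum_indicatorExponent]
    omega

lemma map_koszulD {S T : Type*} [CommRing S] [CommRing T] (φ : S →+* T) (x : Fin n → S)
    (w : Finset (Fin n) → S) (G : Finset (Fin n)) :
    φ (koszulD x w G) = koszulD (fun s => φ (x s)) (fun F => φ (w F)) G := by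
  simp only [koszulD, map_sum, apply_ite φ, map_zero, map_mul, map_pow, map_neg, map_one]

lemma map_aeval_strandSpan (A : Set (Fin n → ℕ)) (F : Finset (Fin n)) :
    (strandSpan k X A F).map (aeval f : MvPolynomial (Fin n) k →ₐ[k] _).toLinearMap
      = strandSpan k f A F := by
  rw [strandSpan, Submodule.map_span, ← Set.image_comp, strandSpan]
  congr 2
  funext c
  simp [prodPow]

lemma exists_koszulD_eq_of_mem_ker (hd : 0 < d) (hf : ∀ i, (f i).IsHomogeneous d) {i j : ℕ}
    (hj : j ≠ 0) (hij : (d ^ n) ^ 2 ^ (m - 1) + (i + 1) ≤ d * j)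
    {z : Finset (Fin n) → MvPolynomial (Fin n) k} (hker : ∀ F, aeval f (z F) = 0)
    (hz : ∀ F, z F ∈ strandSpan k X {a | ∑ s, a s = j} F)
    (hsupp : ∀ F, z F ≠ 0 → F.card = i) (hcyc : ∀ G, koszulD X z G = 0) :
    ∃ w : Finset (Fin n) → MvPolynomial (Fin n) k, (∀ F, aeval f (w F) = 0) ∧
      (∀ F, w F ∈ strandSpan k X {a | ∑ s, a s = j} F) ∧
      (∀ F, w F ≠ 0 → F.card = i + 1) ∧ ∀ G, koszulD X w G = z G := by
  obtain ⟨e, he, hesupp, hez⟩ := exists_koszulD_eq (k := k) X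
    (fun a ha => familyExact_strandFamily_X (ha.trans_ne hj) i) z hz hsupp hcyc
  have hφ : ∀ (w : Finset (Fin n) → MvPolynomial (Fin n) k) G,
      aeval f (koszulD X w G) = koszulD f (fun F => aeval f (w F)) G := fun w G => by
    have h := map_koszulD (aeval f : MvPolynomial (Fin n) k →ₐ[k] _).toRingHom X w G
    simpa using h
  obtain ⟨u, hu, husupp, hue⟩ := exists_koszulD_eq (k := k) f
    (fun a ha => familyExact_strandFamily hd hf (i := i + 1) (ha ▸ hij)) (fun F => aeval f (e F))
    (fun F => map_aeval_strandSpan (f := f) _ F ▸ Submodule.mem_map_of_mem (he F))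
    (fun F hF => hesupp F fun h => hF (by rw [h, map_zero]))
    (fun G => by rw [← hφ, hez, hker])
  have hlift : ∀ F, ∃ g ∈ strandSpan k (X : Fin n → MvPolynomial (Fin n) k) {a | ∑ s, a s = j} F,
      aeval f g = u F ∧ (g ≠ 0 → u F ≠ 0) := fun F => by
    by_cases h0 : u F = 0
    · exact ⟨0, Submodule.zero_mem _, by rw [h0, map_zero], fun h => absurd rfl h⟩
    · obtain ⟨g, hg, hgu⟩ := Submodule.mem_map.1 (map_aeval_strandSpan (f := f) _ F ▸ hu F)
      exact ⟨g, hg, hgu, fun _ => h0⟩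
  choose g hg hgu hgsupp using hlift
  refine ⟨fun F => e F - koszulD X g F, fun F => ?_,
    fun F => sub_mem (he F) (koszulD_mem_strandSpan X hg F), fun F hF => ?_, fun G => ?_⟩
  · rw [map_sub, hφ, sub_eq_zero, ← hue]
    simp only [hgu]
  · by_cases h0 : e F = 0
    · beta_reduce at hF
      rw [h0, zero_sub, neg_ne_zero] at hF
      obtain ⟨t, ht, hne⟩ := exists_of_koszulD_ne_zero hF
      have h1 := husupp _ (hgsupp _ hne)
      rw [Finset.card_insert_of_notMem ht] at h1
      omega
    · exact hesupp F h0
  · rw [koszulD_sub, hez, koszulD_koszulD, sub_zero]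

end Kernel

section Betti

variable {n : ℕ} {I : Ideal (MvPolynomial (Fin n) K)}

/-- A chain of the Koszul complex of degree `i` as a function on all sets of variables. -/
noncomputable def extendChain {i : ℕ} {e : ℤ} (w : KoszulIdx n i → idealPiece I e)
    (F : Finset (Fin n)) : MvPolynomial (Fin n) K :=
  if h : F.card = i then w ⟨F, h⟩ else 0

lemma extendChain_of_card_ne {i : ℕ} {e : ℤ} (w : KoszulIdx n i → idealPiece I e)
    {F : Finset (Fin n)} (h : F.card ≠ i) : extendChain w F = 0 := dif_neg h

lemma coe_koszulDiff_apply {i : ℕ} {j : ℤ}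
    (w : KoszulIdx n (i + 1) → idealPiece I (j - (i + 1 : ℕ))) (G : KoszulIdx n i) :
    (koszulDiff I i j w G : MvPolynomial (Fin n) K) = koszulD X (extendChain w) G := by
  classical
  have h1 : (koszulDiff I i j w G : MvPolynomial (Fin n) K)
      = ∑ s : KoszulIdx n (i + 1), ∑ t : Fin n, if t ∈ s.1 ∧ s.1.erase t = G.1 then
        (-1) ^ (s.1.filter (· < t)).card * (X t * (w s : MvPolynomial (Fin n) K)) else 0 := by
    rw [koszulDiff, LinearMap.sum_apply, Finset.sum_apply, Submodule.coe_sum]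
    refine Finset.sum_congr rfl fun s _ => ?_
    rw [LinearMap.sum_apply, Finset.sum_apply, Submodule.coe_sum]
    simp only [ite_and]
    rw [← Finset.sum_filter, Finset.filter_mem_eq_inter, Finset.univ_inter,
      ← Finset.sum_attach s.1]
    refine Finset.sum_congr rfl fun t _ => ?_
    rw [LinearMap.smul_apply, Pi.smul_apply, Submodule.coe_smul, LinearMap.comp_apply,
      LinearMap.single_apply, Pi.single_apply]
    split_ifs with ha hb hb
    · subst ha
      simp [mulXPiece, Algebra.smul_def]
      rfl
    · exact absurd (congrArg Subtype.val ha).symm hb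
    · exact absurd (Subtype.ext hb.symm) ha
    · simp
  rw [h1, Finset.sum_comm, koszulD]
  refine Finset.sum_congr rfl fun t _ => ?_
  split_ifs with ht
  · refine Finset.sum_eq_zero fun s _ => if_neg ?_
    rintro ⟨-, h⟩
    rw [← h] at ht
    exact Finset.notMem_erase t _ ht
  · have hcard : (insert t G.1).card = i + 1 := by rw [Finset.card_insert_of_notMem ht, G.2]
    rw [Finset.sum_eq_single ⟨insert t G.1, hcard⟩]
    · rw [if_pos ⟨Finset.mem_insert_self _ _, Finset.erase_insert ht⟩, card_filter_lt_insert ht,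
        if_neg (lt_irrefl t), add_zero, extendChain, dif_pos hcard]
    · rintro s - hs
      refine if_neg ?_
      rintro ⟨h1, h2⟩
      exact hs (Subtype.ext ((Finset.insert_erase h1).symm.trans (congrArg (insert t) h2)))
    · simp

lemma koszulD_extendChain_eq_zero {i : ℕ} {j : ℤ} {z : KoszulIdx n i → idealPiece I (j - (i : ℕ))}
    (hz : z ∈ koszulCycles I i j) (G : Finset (Fin n)) : koszulD X (extendChain z) G = 0 := by
  cases i with
  | zero =>
    exact koszulD_eq_zero fun t ht => extendChain_of_card_ne _ (by simp [ht])
  | succ i =>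
    by_cases hG : G.card = i
    · have h : koszulDiff I i j z = 0 := hz
      rw [← coe_koszulDiff_apply z ⟨G, hG⟩, h]
      rfl
    · refine koszulD_eq_zero fun t ht => extendChain_of_card_ne _ ?_
      rwa [Finset.card_insert_of_notMem ht, ne_eq, Nat.add_right_cancel_iff]

lemma mem_idealPiece_natCast {e : ℤ} (e' : ℕ) (he : e = e') {p : MvPolynomial (Fin n) K} :
    p ∈ idealPiece I e ↔ p ∈ I ∧ p ∈ homogeneousSubmodule (Fin n) K e' := by
  subst he
  rw [idealPiece, if_pos (Int.natCast_nonneg _), Int.toNat_natCast, Submodule.mem_inf,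
    Submodule.restrictScalars_mem]

lemma gradedBetti_eq_zero {i : ℕ} {j : ℤ}
    (h : koszulCycles I i j ≤ LinearMap.range (koszulDiff I i j)) : gradedBetti I i j = 0 := by
  rw [gradedBetti, inf_eq_right.2 h, Nat.sub_self]

variable {m d : ℕ} {f : Fin n → MvPolynomial (Fin m) K}

lemma gradedBetti_ker_eq_zero (hd : 0 < d) (hf : ∀ i, (f i).IsHomogeneous d) {i j : ℕ}
    (hlt : i < j) (hij : (d ^ n) ^ 2 ^ (m - 1) + (i + 1) ≤ d * j) :
    gradedBetti (RingHom.ker (aeval f : MvPolynomial (Fin n) K →ₐ[K] MvPolynomial (Fin m) K)) i j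
      = 0 := by
  refine gradedBetti_eq_zero fun z hz => ?_
  have he0 : (j : ℤ) - (i : ℕ) = (j - i : ℕ) := by omega
  have he1 : (j : ℤ) - (i + 1 : ℕ) = (j - (i + 1) : ℕ) := by omega
  obtain ⟨w, hwker, hw, hwsupp, hwz⟩ := exists_koszulD_eq_of_mem_ker hd hf (i := i) (j := j)
    (z := extendChain z) (by omega) hij
    (fun F => by
      unfold extendChain
      split_ifs with h
      · exact ((mem_idealPiece_natCast _ he0).1 (z ⟨F, h⟩).2).1
      · exact map_zero _)
    (fun F => by
      unfold extendChain
      split_ifs with h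
      · rw [strandSpan_X (e := j - i) (by omega)]
        exact ((mem_idealPiece_natCast _ he0).1 (z ⟨F, h⟩).2).2
      · exact zero_mem _)
    (fun F hF => by
      by_contra h
      exact hF (extendChain_of_card_ne z h))
    (koszulD_extendChain_eq_zero hz)
  refine ⟨fun F => ⟨w F.1, (mem_idealPiece_natCast _ he1).2 ⟨hwker F.1, ?_⟩⟩, ?_⟩
  · rw [← strandSpan_X (j := j) (F := F.1) (by rw [F.2]; omega)]
    exact hw F.1
  · funext G
    refine Subtype.ext ?_
    rw [coe_koszulDiff_apply]
    refine ((koszulD_congr fun t ht => ?_).trans (hwz G.1)).trans (dif_pos G.2)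
    unfold extendChain
    split_ifs with h
    · rfl
    · by_contra h0
      exact h (hwsupp _ (Ne.symm h0))

end Betti

/-- **Main theorem** (Cioffi–Conca).  Let `P` be the kernel of the `K`-algebra map
`φ : K[x_1,…,x_n] → K[y_1,…,y_m]` with `φ(x_i) = f_i`, the `f_i` homogeneous of common
degree `d > 0`.  Then `reg(P) ≤ d^(n·2^(m-1) - 1)`. -/
theorem reg_kernel_le {n m : ℕ} (d : ℕ) (hd : 0 < d)
    (f : Fin n → MvPolynomial (Fin m) K) (hf : ∀ i, (f i).IsHomogeneous d) :
    reg (RingHom.ker (aeval f : MvPolynomial (Fin n) K →ₐ[K] MvPolynomial (Fin m) K)) ≤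
      (d : ℤ) ^ (n * 2 ^ (m - 1) - 1) := by
  have hle : ∀ r ∈ {r : ℤ | ∃ (i : ℕ) (j : ℤ), gradedBetti (RingHom.ker (aeval f :
      MvPolynomial (Fin n) K →ₐ[K] MvPolynomial (Fin m) K)) i j ≠ 0 ∧ r = j - i},
      r ≤ (d : ℤ) ^ (n * 2 ^ (m - 1) - 1) := by
    rintro _ ⟨i, j, hne, rfl⟩
    by_contra! hlt
    have hpos : (0 : ℤ) < (d : ℤ) ^ (n * 2 ^ (m - 1) - 1) := by positivity
    lift j to ℕ using by omega
    refine hne (gradedBetti_ker_eq_zero hd hf (by omega) ?_)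
    have h1 : d ^ (n * 2 ^ (m - 1) - 1) + (i + 1) ≤ j := by
      zify
      omega
    have h2 : (d ^ n) ^ 2 ^ (m - 1) ≤ d * d ^ (n * 2 ^ (m - 1) - 1) := by
      rw [← pow_mul, ← pow_succ']
      exact Nat.pow_le_pow_right hd (by omega)
    nlinarith [Nat.mul_le_mul_left d h1, Nat.le_mul_of_pos_left (i + 1) hd]
  rw [reg]
  rcases Set.eq_empty_or_nonempty {r : ℤ | ∃ (i : ℕ) (j : ℤ), gradedBetti (RingHom.ker (aeval f :
      MvPolynomial (Fin n) K →ₐ[K] MvPolynomial (Fin m) K)) i j ≠ 0 ∧ r = j - i} with h | h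
  · rw [h, Int.csSup_empty]
    positivity
  · exact csSup_le h hle
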